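/- arXiv:2103.17148 — 4 statements merged into one kernel-verified Lean document; each statement's English description precedes it below -/
import Mathlib

section
/- Fix g*, N̂ ∈ ℕ, a compact domain D ⊂ ℂ, and z ∈ D. Let T̂ be the N̂×N̂ upper-triangular Toeplitz matrix with symbol p̂_z(τ) = ∑_{j=0}^{g*} â_{−j}(z) τ^{−j}, where â₀(z) ≠ 0 and â_{−g*}(z) = 1 for all z ∈ D; equivalently T̂ = ∏_{j=1}^{g*} (J_{N̂} − η̂_j(z) I_{N̂}), where {η̂_j(z)}_{j=1}^{g*} are the roots of p̂_z(·) = 0. Assume inf_{z∈D} min_{k≠j} |1 − η̂_j(z)/η̂_k(z)| ≥ c₁ for some c₁ ∈ (0,1). Then for any 𝔛 = {𝔵₁ < … < 𝔵_n} ⊂ [N̂] and 𝔜 = {𝔶₁ < … < 𝔶_n} ⊂ [N̂], |det(T̂[𝔛^∁; 𝔜^∁])| ≤ c₁^{−g* n} · g*^{2n} · ∏_{j=1}^{g*} |η̂_j(z)|^{N̂−n} · (min_{j=1}^{g*} |η̂_j(z)|)^{ȳ−x̄} · ∏_{i=1}^n 1{𝔵_i ≥ 𝔶_i} · ∏_{i=1}^{n−g*}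 1{𝔵_i < 𝔶_{i+g*}}, where x̄ := ∑_{i=1}^n 𝔵_i and ȳ := ∑_{i=1}^n 𝔶_i. -/
/-!
Bound on minors of banded upper-triangular Toeplitz matrices via skew Schur polynomials
(Proposition `prop:toep-minor`).
-/

open Finset
open scoped Classical

noncomputable section

/-- The elementary Jordan block `J(i,j) = 1` iff `j = i + 1`. -/
def jordanM (n : ℕ) : Matrix (Fin n) (Fin n) ℂ :=
  Matrix.of fun i j => if (i : ℕ) + 1 = (j : ℕ) then 1 else 0

/-- The upper-triangular banded Toeplitz matrix
`T̂ = ∏_{j=1}^{g⋆} (J - η̂_j I)`, whose symbol is `p̂(τ) = ∏_j (τ⁻¹ - η̂_j)`,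
i.e. `p̂(τ) = ∑_{j=0}^{g⋆} â_{-j} τ^{-j}` with `â_{-g⋆} = 1` and roots `η̂_j`. -/
def toepFromRoots (n gs : ℕ) (ηh : Fin gs → ℂ) : Matrix (Fin n) (Fin n) ℂ :=
  (((List.finRange gs).map fun l => jordanM n - ηh l • (1 : Matrix (Fin n) (Fin n) ℂ))).prod

/-- The minor `det (A[X; Y])` of `A`, rows `X` and columns `Y` in increasing order. -/
def minorDet {N : ℕ} (A : Matrix (Fin N) (Fin N) ℂ) (X Y : Finset (Fin N)) : ℂ :=
  if h : Y.card = X.card then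
    Matrix.det (Matrix.of fun i j : Fin X.card =>
      A ((X.orderIsoOfFin rfl i : Fin N)) ((Y.orderIsoOfFin h j : Fin N)))
  else 0

lemma norm_det_submatrix_equiv {m k : Type*} [Fintype m] [DecidableEq m] [Fintype k]
    [DecidableEq k] (e f : m ≃ k) (A : Matrix k k ℂ) :
    ‖(A.submatrix e f).det‖ = ‖A.det‖ := by
  have h : A.submatrix e f = (A.submatrix id (e.symm.trans f)).submatrix e e := by
    ext i j
    simp
  rw [h, Matrix.det_submatrix_equiv_self, Matrix.det_permute', norm_mul]
  rcases Int.units_eq_one_or (Equiv.Perm.sign (e.symm.trans f)) with hs | hs <;> simp [hs]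

/-- Jacobi's complementary minor formula, up to sign. -/
lemma norm_minorDet_compl {N n : ℕ} {A B : Matrix (Fin N) (Fin N) ℂ} (hAB : A * B = 1)
    (X Y : Finset (Fin N)) (hX : X.card = n) (hY : Y.card = n) :
    ‖minorDet A Xᶜ Yᶜ‖ = ‖A.det‖ *
      ‖Matrix.det (Matrix.of fun i j : Fin n =>
        B (Y.orderIsoOfFin hY i : Fin N) (X.orderIsoOfFin hX j : Fin N))‖ := by
  have hc : Yᶜ.card = Xᶜ.card := by rw [card_compl, card_compl, hX, hY]
  let e := finSumEquivOfFinset hX (rfl : Xᶜ.card = Xᶜ.card)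
  let f := finSumEquivOfFinset hY hc
  have hone : A.submatrix e f * B.submatrix f e = 1 := by
    rw [Matrix.submatrix_mul_equiv, hAB, Matrix.submatrix_one_equiv]
  rw [← norm_det_submatrix_equiv e f A, minorDet, dif_pos hc, ← norm_mul]
  set A' := A.submatrix e f with hA'
  set B' := B.submatrix f e with hB'
  have hmul : A' * Matrix.fromBlocks B'.toBlocks₁₁ 0 B'.toBlocks₂₁ 1 =
      Matrix.fromBlocks 1 A'.toBlocks₁₂ 0 A'.toBlocks₂₂ := by
    rw [← Matrix.fromBlocks_toBlocks A', ← Matrix.fromBlocks_toBlocks B',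
      Matrix.fromBlocks_multiply, ← Matrix.fromBlocks_one, Matrix.fromBlocks_inj] at hone
    conv_lhs => rw [← Matrix.fromBlocks_toBlocks A']
    rw [Matrix.fromBlocks_multiply, hone.1, hone.2.2.1]
    simp
  have hdet := congrArg Matrix.det hmul
  rw [Matrix.det_mul, Matrix.det_fromBlocks_zero₁₂, Matrix.det_fromBlocks_zero₂₁,
    Matrix.det_one, Matrix.det_one, mul_one, one_mul] at hdet
  exact congrArg norm hdet.symm

open scoped Matrix in
/-- A square matrix is singular if some of its columns factor through too few coordinates. -/
lemma det_eq_zero_of_cols_factor {n : ℕ} {κ : Type*} [Fintype κ] (M : Matrix (Fin n) (Fin n) ℂ)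
    (S : Finset (Fin n)) (P : Fin n → κ → ℂ) (Q : κ → Fin n → ℂ)
    (h : ∀ a, ∀ b ∈ S, M a b = ∑ k, P a k * Q k b) (hc : Fintype.card κ < S.card) :
    M.det = 0 := by
  let Q' : Matrix κ S ℂ := Matrix.of fun k b => Q k b
  have hker : LinearMap.ker Q'.mulVecLin ≠ ⊥ := by
    apply LinearMap.ker_ne_bot_of_finrank_lt
    simpa using hc
  obtain ⟨w, hw, hw0⟩ := (Submodule.ne_bot_iff _).mp hker
  have hfac : M.submatrix id (Subtype.val : S → Fin n) = (Matrix.of P) * Q' := by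
    ext a b
    simp [Matrix.mul_apply, Q', h a b b.2]
  have hz : M.submatrix id (Subtype.val : S → Fin n) *ᵥ w = 0 := by
    rw [hfac, ← Matrix.mulVec_mulVec]
    have : Q' *ᵥ w = 0 := hw
    rw [this, Matrix.mulVec_zero]
  rw [← Matrix.exists_mulVec_eq_zero_iff]
  refine ⟨fun b => if hb : b ∈ S then w ⟨b, hb⟩ else 0, ?_, ?_⟩
  · intro h0
    apply hw0
    ext b
    simpa using congrFun h0 b
  · ext a
    have := congrFun hz a
    simp only [Matrix.mulVec, dotProduct, Matrix.submatrix_apply, id] at this ⊢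
    rw [← Finset.sum_subset (Finset.subset_univ S), ← Finset.sum_coe_sort S]
    · simpa using this
    · intro b _ hb
      simp [hb]

/-- Determinant bound for matrices with at most `g - 1` nonzero subdiagonals. -/
lemma norm_det_le_of_lower_band (g : ℕ) : ∀ {n : ℕ} (M : Matrix (Fin n) (Fin n) ℂ)
    (u v : Fin n → ℝ), (∀ i, 0 ≤ u i) → (∀ i, 0 ≤ v i) → (∀ i j, ‖M i j‖ ≤ u i * v j) →
    (∀ i j : Fin n, (j : ℕ) + g ≤ i → M i j = 0) →
    ‖M.det‖ ≤ (g : ℝ) ^ n * (∏ i, u i) * ∏ j, v j := by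
  intro n
  induction n with
  | zero => intro M u v _ _ _ _; simp
  | succ n ih =>
    intro M u v hu hv hM hband
    let c : ℝ := (g : ℝ) ^ n * (∏ i, u i) * ∏ j, v j
    have hc : 0 ≤ c := by
      have := Finset.prod_nonneg fun i (_ : i ∈ univ) => hu i
      have := Finset.prod_nonneg fun i (_ : i ∈ univ) => hv i
      positivity
    let S : Finset (Fin (n + 1)) := univ.filter fun j => n < (j : ℕ) + g
    have hS : S.card ≤ g := by
      have : S.card ≤ (Finset.Ioc n (n + g)).card := by
        apply Finset.card_le_card_of_injOn (fun j : Fin (n + 1) => (j : ℕ) + g)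
        · intro j hj
          have h1 := (Finset.mem_filter.mp hj).2
          have h2 := j.2
          simp only [Finset.coe_Ioc, Set.mem_Ioc]
          omega
        · intro a _ b _ hab
          simp only [] at hab
          exact Fin.ext (by omega)
      simpa using this
    rw [Matrix.det_succ_row M (Fin.last n)]
    have hterm : ∀ j ∈ S, ‖(-1 : ℂ) ^ ((Fin.last n : ℕ) + (j : ℕ)) * M (Fin.last n) j *
        (M.submatrix (Fin.last n).succAbove j.succAbove).det‖ ≤ c := by
      intro j hj
      have hj' : n < (j : ℕ) + g := (Finset.mem_filter.mp hj).2
      have hminor := ih (M.submatrix (Fin.last n).succAbove j.succAbove)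
        (fun i => u i.castSucc) (fun i => v (j.succAbove i)) (fun i => hu _) (fun i => hv _)
        (fun a b => by simpa using hM a.castSucc (j.succAbove b))
        (fun a b hab => by
          simp only [Matrix.submatrix_apply, Fin.succAbove_last]
          apply hband
          have ha := a.2
          rcases lt_or_ge b.castSucc j with hb | hb
          · rw [Fin.succAbove_of_castSucc_lt _ _ hb]
            simpa using hab
          · have : (j : ℕ) ≤ b := hb
            omega)
      rw [norm_mul, norm_mul, norm_pow, norm_neg, norm_one, one_pow, one_mul]
      calc _ ≤ (u (Fin.last n) * v j) * ((g : ℝ) ^ n * (∏ i : Fin n, u i.castSucc) *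
            ∏ i, v (j.succAbove i)) :=
            mul_le_mul (hM _ _) hminor (norm_nonneg _) (mul_nonneg (hu _) (hv _))
        _ = c := by
          simp only [c]
          rw [Fin.prod_univ_castSucc u, Fin.prod_univ_succAbove v j]
          ring
    rw [← Finset.sum_subset (Finset.subset_univ S)]
    · calc _ ≤ ∑ j ∈ S, c := norm_sum_le_of_le _ hterm
        _ = S.card * c := by simp
        _ ≤ g * c := by gcongr
        _ = _ := by simp only [c]; ring
    · intro j _ hj
      have : M (Fin.last n) j = 0 := hband _ _ (by simpa [S] using hj)
      simp [this]

/-- The inverse of `J - x I`. -/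
def shiftedJordanInv (n : ℕ) (x : ℂ) : Matrix (Fin n) (Fin n) ℂ :=
  Matrix.of fun a b => if a ≤ b then -x⁻¹ ^ ((b : ℕ) - a + 1) else 0

lemma sub_smul_mul_shiftedJordanInv (n : ℕ) {x : ℂ} (hx : x ≠ 0) :
    (jordanM n - x • (1 : Matrix (Fin n) (Fin n) ℂ)) * shiftedJordanInv n x = 1 := by
  ext a b
  rw [sub_mul, Matrix.sub_apply, smul_mul_assoc, one_mul, Matrix.smul_apply, Matrix.mul_apply]
  have hJ : ∑ c, jordanM n a c * shiftedJordanInv n x c b =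
      if a < b then -x⁻¹ ^ ((b : ℕ) - a) else 0 := by
    by_cases ha : (a : ℕ) + 1 < n
    · rw [Finset.sum_eq_single (⟨a + 1, ha⟩ : Fin n)]
      · have : (⟨a + 1, ha⟩ : Fin n) ≤ b ↔ a < b := by
          rw [Fin.le_def, Fin.lt_def]; exact Iff.rfl
        simp only [jordanM, shiftedJordanInv, Matrix.of_apply, this, if_true, one_mul]
        refine ite_congr rfl (fun h => ?_) (fun _ => rfl)
        rw [Fin.lt_def] at h
        congr 2
        omega
      · intro c _ hc
        have : (a : ℕ) + 1 ≠ c := fun h => hc (Fin.ext h.symm)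
        simp [jordanM, this]
      · simp
    · rw [Finset.sum_eq_zero, if_neg]
      · rw [Fin.lt_def]; omega
      · intro c _
        have : (a : ℕ) + 1 ≠ c := by omega
        simp [jordanM, this]
  rw [hJ]
  rcases lt_trichotomy a b with h | h | h
  · rw [Matrix.one_apply_ne h.ne]
    simp only [shiftedJordanInv, Matrix.of_apply, h, h.le, if_true, smul_eq_mul, pow_succ]
    field_simp
    ring
  · subst h
    simp [shiftedJordanInv, hx]
  · rw [Matrix.one_apply_ne h.ne']
    simp [shiftedJordanInv, h.not_gt, h.not_ge]

open Polynomial in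
lemma toepFromRoots_eq_aeval (n gs : ℕ) (η : Fin gs → ℂ) :
    toepFromRoots n gs η = aeval (jordanM n) (∏ l, (X - C (η l))) := by
  rw [Fin.prod_univ_def, map_list_prod, List.map_map, toepFromRoots]
  congr 2
  funext l
  simp [Algebra.algebraMap_eq_smul_one]

/-- Partial fraction decomposition of the inverse of the Toeplitz matrix. -/
def toepInv (n gs : ℕ) (η : Fin gs → ℂ) : Matrix (Fin n) (Fin n) ℂ :=
  ∑ l, (∏ m ∈ univ.erase l, (η l - η m)⁻¹) • shiftedJordanInv n (η l)

open Polynomial in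
lemma toepFromRoots_mul_toepInv (n : ℕ) {gs : ℕ} (hgs : 0 < gs) {η : Fin gs → ℂ}
    (hη : ∀ j, η j ≠ 0) (hinj : Function.Injective η) :
    toepFromRoots n gs η * toepInv n gs η = 1 := by
  have hbasis : ∑ l, Lagrange.basis univ η l = 1 :=
    Lagrange.sum_basis (hinj.injOn) ⟨⟨0, hgs⟩, mem_univ _⟩
  have := congrArg (aeval (jordanM n)) hbasis
  rw [map_one, map_sum] at this
  rw [← this, toepInv, Finset.mul_sum]
  refine Finset.sum_congr rfl fun l _ => ?_
  have hsplit : (∏ l, (X - C (η l))) = (∏ m ∈ univ.erase l, (X - C (η m))) * (X - C (η l)) :=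
    (Finset.prod_erase_mul _ _ (mem_univ l)).symm
  rw [toepFromRoots_eq_aeval, hsplit, map_mul, mul_smul_comm, mul_assoc]
  have hlin : aeval (jordanM n) (X - C (η l)) = jordanM n - η l • 1 := by
    simp [Algebra.algebraMap_eq_smul_one]
  rw [hlin, sub_smul_mul_shiftedJordanInv n (hη l), mul_one, Lagrange.basis]
  simp only [Lagrange.basisDivisor]
  rw [Finset.prod_mul_distrib, ← map_prod, map_mul, aeval_C, Algebra.algebraMap_eq_smul_one,
    smul_mul_assoc, one_mul]

lemma norm_det_toepFromRoots (n gs : ℕ) (η : Fin gs → ℂ) :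
    ‖(toepFromRoots n gs η).det‖ = (∏ j, ‖η j‖) ^ n := by
  have hfac : ∀ x : ℂ, (jordanM n - x • (1 : Matrix (Fin n) (Fin n) ℂ)).det = (-x) ^ n := by
    intro x
    rw [Matrix.det_of_isUpperTriangular]
    · simp [jordanM]
    · intro i j hij
      have hij' : j < i := hij
      have h1 : (i : ℕ) + 1 ≠ j := by rw [Fin.lt_def] at hij'; omega
      simp [jordanM, h1, Matrix.one_apply_ne hij'.ne']
  have : (toepFromRoots n gs η).det = ∏ l, (-η l) ^ n := by
    rw [toepFromRoots, ← Matrix.coe_detMonoidHom, map_list_prod, List.map_map, Fin.prod_univ_def]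
    congr 2
    funext l
    exact hfac (η l)
  rw [this, norm_prod, ← Finset.prod_pow]
  simp

lemma toepInv_apply (n gs : ℕ) (η : Fin gs → ℂ) (a b : Fin n) :
    toepInv n gs η a b = if a ≤ b then
      ∑ l, (∏ m ∈ univ.erase l, (η l - η m)⁻¹) * -(η l)⁻¹ ^ ((b : ℕ) - a + 1) else 0 := by
  rw [toepInv, Matrix.sum_apply]
  split_ifs with h <;> simp [shiftedJordanInv, h]

lemma norm_toepInv_le (n : ℕ) {gs : ℕ} {η : Fin gs → ℂ} (hη : ∀ j, η j ≠ 0) {c : ℝ} (hc : 0 < c)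
    (hc1 : c ≤ 1) (hsep : ∀ k j, k ≠ j → c ≤ ‖1 - η j / η k‖) {μ : ℝ} (hμ : 0 < μ)
    (hμη : ∀ j, μ ≤ ‖η j‖) (a b : Fin n) :
    ‖toepInv n gs η a b‖ ≤
      (gs * (c ^ gs)⁻¹ * (∏ j, ‖η j‖)⁻¹ * μ ^ (a : ℕ)) * (μ ^ (b : ℕ))⁻¹ := by
  rw [toepInv_apply]
  split_ifs with hab
  swap
  · simp only [norm_zero]
    positivity
  have hcoef : ∀ l, ‖∏ m ∈ univ.erase l, (η l - η m)⁻¹‖ ≤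
      (c ^ gs)⁻¹ * ∏ m ∈ univ.erase l, ‖η m‖⁻¹ := by
    intro l
    rw [norm_prod]
    calc _ ≤ ∏ m ∈ univ.erase l, (c⁻¹ * ‖η m‖⁻¹) := by
          refine Finset.prod_le_prod (fun _ _ => norm_nonneg _) fun m hm => ?_
          have hs := hsep m l (Finset.ne_of_mem_erase hm)
          have hm0 : 0 < ‖η m‖ := norm_pos_iff.mpr (hη m)
          rw [norm_inv, ← mul_inv]
          apply inv_anti₀ (by positivity)
          have : η l - η m = -((1 - η l / η m) * η m) := by
            field_simp [hη m]
            ring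
          rw [this, norm_neg, norm_mul]
          gcongr
      _ = (c ^ (gs - 1))⁻¹ * ∏ m ∈ univ.erase l, ‖η m‖⁻¹ := by
          rw [Finset.prod_mul_distrib, Finset.prod_const, Finset.card_erase_of_mem (mem_univ l)]
          simp
      _ ≤ _ := by
          gcongr ?_ * _
          exact inv_anti₀ (by positivity) (pow_le_pow_of_le_one hc.le hc1 (Nat.sub_le _ _))
  have hterm : ∀ l ∈ (univ : Finset (Fin gs)),
      ‖(∏ m ∈ univ.erase l, (η l - η m)⁻¹) * -(η l)⁻¹ ^ ((b : ℕ) - a + 1)‖ ≤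
      (c ^ gs)⁻¹ * (∏ j, ‖η j‖)⁻¹ * (μ ^ ((b : ℕ) - a))⁻¹ := by
    intro l _
    rw [norm_mul, norm_neg, norm_pow, norm_inv, pow_succ]
    have hl0 : 0 < ‖η l‖ := norm_pos_iff.mpr (hη l)
    calc _ ≤ ((c ^ gs)⁻¹ * ∏ m ∈ univ.erase l, ‖η m‖⁻¹) *
          ((μ ^ ((b : ℕ) - a))⁻¹ * ‖η l‖⁻¹) := by
          gcongr
          · exact hcoef l
          · rw [inv_pow]
            exact inv_anti₀ (by positivity) (pow_le_pow_left₀ hμ.le (hμη l) _)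
      _ = _ := by
          rw [← Finset.prod_inv_distrib, ← Finset.prod_erase_mul _ _ (mem_univ l)]
          ring
  refine (norm_sum_le_of_le _ hterm).trans (le_of_eq ?_)
  have hpow : μ ^ (b : ℕ) = μ ^ ((b : ℕ) - a) * μ ^ (a : ℕ) := by
    rw [← pow_add, Nat.sub_add_cancel hab]
  rw [hpow]
  simp only [sum_const, card_univ, Fintype.card_fin, nsmul_eq_mul]
  field_simp

/-- A square matrix is singular if its rows `≥ i` vanish on the columns `≤ i`. -/
lemma det_eq_zero_of_zero_corner {n : ℕ} (M : Matrix (Fin n) (Fin n) ℂ) (i : Fin n)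
    (h : ∀ a b, i ≤ a → b ≤ i → M a b = 0) : M.det = 0 := by
  refine det_eq_zero_of_cols_factor (κ := Fin (i : ℕ)) M (Finset.Iic i)
    (fun a k => if (a : ℕ) = k then 1 else 0) (fun k b => M (Fin.castLE i.2.le k) b) ?_ ?_
  · intro a b hb
    rcases lt_or_ge a i with ha | ha
    · rw [Finset.sum_eq_single (⟨a, ha⟩ : Fin (i : ℕ))]
      · simp
      · intro k _ hk
        rw [if_neg fun h => hk (Fin.ext h.symm), zero_mul]
      · simp
    · rw [h a b ha (Finset.mem_Iic.mp hb), Finset.sum_eq_zero]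
      intro k _
      have : (a : ℕ) ≠ k := by
        have := k.2
        rw [Fin.le_def] at ha
        omega
      simp [this]
  · simp

open scoped Matrix in
/-- A square matrix is singular if its corner of rows `≤ i + g` and columns `≥ i` has rank at
most `g`. -/
lemma det_eq_zero_of_low_rank_corner {n g : ℕ} (M : Matrix (Fin n) (Fin n) ℂ) (i : Fin n)
    (hi : (i : ℕ) + g < n) (U V : Fin g → Fin n → ℂ)
    (h : ∀ a b : Fin n, (a : ℕ) ≤ i + g → i ≤ b → M a b = ∑ l, U l a * V l b) : M.det = 0 := by
  rw [← Matrix.det_transpose]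
  refine det_eq_zero_of_cols_factor (κ := Fin (i : ℕ) ⊕ Fin g) Mᵀ (Finset.Iic ⟨i + g, hi⟩)
    (fun b k => Sum.elim (fun k : Fin (i : ℕ) => if (b : ℕ) = k then 1 else 0)
      (fun l => if i ≤ b then V l b else 0) k)
    (fun k a => Sum.elim (fun k : Fin (i : ℕ) => M a (Fin.castLE i.2.le k)) (fun l => U l a) k)
    ?_ ?_
  · intro b a ha
    have ha' : a ≤ ⟨i + g, hi⟩ := Finset.mem_Iic.mp ha
    simp only [Fintype.sum_sum_type, Sum.elim_inl, Sum.elim_inr, Matrix.transpose_apply]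
    rcases lt_or_ge b i with hb | hb
    · rw [Finset.sum_eq_single (⟨b, hb⟩ : Fin (i : ℕ))]
      · simp [hb.not_ge]
      · intro k _ hk
        rw [if_neg fun h => hk (Fin.ext h.symm), zero_mul]
      · simp
    · rw [Finset.sum_eq_zero, h a b ha' hb, zero_add]
      · simp [hb, mul_comm]
      · intro k _
        have : (b : ℕ) ≠ k := by
          have := k.2
          rw [Fin.le_def] at hb
          omega
        simp [this]
  · simp

/-- **Proposition (bound on Toeplitz minors).** If the root ratios are uniformly separated
from `1` on the compact set `D`, then for every `𝔛, 𝔜 ⊆ [N̂]` of size `n`,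
`|det T̂[𝔛^∁; 𝔜^∁]| ≤ c₁^{-g⋆ n} g⋆^{2n} ∏_j |η̂_j|^{N̂-n} (min_j |η̂_j|)^{ȳ-x̄} ·
∏ 1{𝔵_i ≥ 𝔶_i} · ∏ 1{𝔵_i < 𝔶_{i+g⋆}}`. -/
theorem toeplitz_minor_bound
    (gs Nh : ℕ) (hgs : 0 < gs) (hNh : 0 < Nh)
    (D : Set ℂ) (hD : IsCompact D) (z : ℂ) (hz : z ∈ D)
    (ηh : ℂ → Fin gs → ℂ)
    (hroots : ∀ w ∈ D, ∀ j, ηh w j ≠ 0)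
    (c₁ : ℝ) (hc₁ : 0 < c₁) (hc₁1 : c₁ < 1)
    (hsep : ∀ w ∈ D, ∀ k j : Fin gs, k ≠ j → c₁ ≤ ‖1 - ηh w j / ηh w k‖)
    (n : ℕ) (X Y : Finset (Fin Nh)) (hX : X.card = n) (hY : Y.card = n) :
    ‖minorDet (toepFromRoots Nh gs (ηh z)) Xᶜ Yᶜ‖ ≤
      c₁ ^ (-(gs * n : ℤ)) * (gs : ℝ) ^ (2 * n) *
      (∏ j, ‖ηh z j‖) ^ (Nh - n) *
      (⨅ j, ‖ηh z j‖) ^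
        ((∑ i, ((Y.orderIsoOfFin hY i : Fin Nh) : ℕ) : ℤ) -
          (∑ i, ((X.orderIsoOfFin hX i : Fin Nh) : ℕ) : ℤ)) *
      (∏ i : Fin n,
        if (Y.orderIsoOfFin hY i : Fin Nh) ≤ (X.orderIsoOfFin hX i : Fin Nh) then (1 : ℝ)
        else 0) *
      (∏ i : Fin n,
        if h : (i : ℕ) + gs < n then
          (if (X.orderIsoOfFin hX i : Fin Nh) < (Y.orderIsoOfFin hY ⟨(i : ℕ) + gs, h⟩ : Fin Nh)
            then (1 : ℝ) else 0)
        else 1) := by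
  have hη := hroots z hz
  have hinj : Function.Injective (ηh z) := by
    intro j k hjk
    by_contra hne
    have := hsep z hz k j (Ne.symm hne)
    rw [hjk, div_self (hη k), sub_self, norm_zero] at this
    linarith
  set η := ηh z with hηdef
  set x : Fin n → Fin Nh := fun i => X.orderIsoOfFin hX i with hx
  set y : Fin n → Fin Nh := fun i => Y.orderIsoOfFin hY i with hy
  have hxm : Monotone x := fun a b hab => (X.orderIsoOfFin hX).monotone hab
  have hym : Monotone y := fun a b hab => (Y.orderIsoOfFin hY).monotone hab
  have hJ := norm_minorDet_compl (toepFromRoots_mul_toepInv Nh hgs hη hinj) X Y hX hY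
  rw [norm_det_toepFromRoots] at hJ
  set M : Matrix (Fin n) (Fin n) ℂ := Matrix.of fun i j => toepInv Nh gs η (y i) (x j) with hMdef
  change ‖minorDet (toepFromRoots Nh gs η) Xᶜ Yᶜ‖ = (∏ j, ‖η j‖) ^ Nh * ‖M.det‖ at hJ
  have : Nonempty (Fin gs) := ⟨⟨0, hgs⟩⟩
  set μ : ℝ := ⨅ j, ‖η j‖ with hμdef
  have hμη : ∀ j, μ ≤ ‖η j‖ := fun j => ciInf_le (Set.finite_range _).bddBelow j
  have hμ : 0 < μ := by
    obtain ⟨j, hj⟩ := exists_eq_ciInf_of_finite (f := fun j => ‖η j‖)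
    rw [hμdef, ← hj]
    exact norm_pos_iff.mpr (hη j)
  have hP : 0 < ∏ j, ‖η j‖ := Finset.prod_pos fun j _ => norm_pos_iff.mpr (hη j)
  change _ ≤ _ * _ * _ * μ ^ ((∑ i, (((y i : Fin Nh) : ℕ) : ℤ)) - ∑ i, (((x i : Fin Nh) : ℕ) : ℤ)) *
    (∏ i : Fin n, if y i ≤ x i then (1 : ℝ) else 0) *
    (∏ i : Fin n, if h : (i : ℕ) + gs < n then (if x i < y ⟨(i : ℕ) + gs, h⟩ then (1 : ℝ) else 0)
      else 1)
  by_cases h1 : ∀ i, y i ≤ x i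
  swap
  · push Not at h1
    obtain ⟨i, hi⟩ := h1
    have hdet : M.det = 0 := by
      refine det_eq_zero_of_zero_corner M i fun a b ha hb => ?_
      rw [hMdef, Matrix.of_apply, toepInv_apply, if_neg]
      exact not_le.mpr (((hxm hb).trans_lt hi).trans_le (hym ha))
    rw [hJ, hdet, norm_zero, mul_zero,
      Finset.prod_eq_zero (f := fun i => if y i ≤ x i then (1 : ℝ) else 0) (mem_univ i)
        (if_neg (not_le.mpr hi))]
    simp
  by_cases h2 : ∀ (i : Fin n) (h : (i : ℕ) + gs < n), x i < y ⟨i + gs, h⟩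
  swap
  · push Not at h2
    obtain ⟨i, hin, hi⟩ := h2
    have hdet : M.det = 0 := by
      refine det_eq_zero_of_low_rank_corner M i hin
        (fun l a => (∏ m ∈ univ.erase l, (η l - η m)⁻¹) * η l ^ (y a : ℕ))
        (fun l b => -(η l)⁻¹ ^ ((x b : ℕ) + 1)) fun a b ha hb => ?_
      have hab : y a ≤ x b :=
        (hym (show a ≤ ⟨i + gs, hin⟩ from ha)).trans (hi.trans (hxm hb))
      rw [hMdef, Matrix.of_apply, toepInv_apply, if_pos hab]
      refine Finset.sum_congr rfl fun l _ => ?_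
      have hpow : (η l)⁻¹ ^ ((x b : ℕ) + 1) =
          (η l)⁻¹ ^ ((x b : ℕ) - y a + 1) * (η l)⁻¹ ^ (y a : ℕ) := by
        rw [← pow_add]
        congr 1
        rw [Fin.le_def] at hab
        omega
      have hcancel : η l ^ (y a : ℕ) * (η l)⁻¹ ^ (y a : ℕ) = 1 := by
        rw [← mul_pow, mul_inv_cancel₀ (hη l), one_pow]
      rw [hpow]
      linear_combination (∏ m ∈ univ.erase l, (η l - η m)⁻¹) *
        (η l)⁻¹ ^ ((x b : ℕ) - y a + 1) * hcancel
    rw [hJ, hdet, norm_zero, mul_zero,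
      Finset.prod_eq_zero (f := fun i : Fin n => if h : (i : ℕ) + gs < n then
        (if x i < y ⟨(i : ℕ) + gs, h⟩ then (1 : ℝ) else 0) else 1) (mem_univ i)
        (by rw [dif_pos hin, if_neg (not_lt.mpr hi)])]
    simp
  rw [Finset.prod_eq_one (f := fun i => if y i ≤ x i then (1 : ℝ) else 0)
      fun i _ => if_pos (h1 i),
    Finset.prod_eq_one (f := fun i : Fin n => if h : (i : ℕ) + gs < n then
        (if x i < y ⟨(i : ℕ) + gs, h⟩ then (1 : ℝ) else 0) else 1)
      fun i _ => by
        by_cases hin : (i : ℕ) + gs < n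
        · rw [dif_pos hin, if_pos (h2 i hin)]
        · rw [dif_neg hin], mul_one, mul_one, hJ]
  have hbound := norm_det_le_of_lower_band gs M
    (fun i => gs * (c₁ ^ gs)⁻¹ * (∏ j, ‖η j‖)⁻¹ * μ ^ (y i : ℕ)) (fun j => (μ ^ (x j : ℕ))⁻¹)
    (fun i => by positivity) (fun j => by positivity)
    (fun i j => norm_toepInv_le Nh hη hc₁ hc₁1.le (hsep z hz) hμ hμη (y i) (x j))
    (fun i j hij => by
      rw [hMdef, Matrix.of_apply, toepInv_apply, if_neg]
      exact not_le.mpr ((h2 j (hij.trans_lt i.2)).trans_le (hym hij)))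
  refine (mul_le_mul_of_nonneg_left hbound (by positivity)).trans (le_of_eq ?_)
  have hn : n ≤ Nh := by
    rw [← hX]
    exact (Finset.card_le_univ X).trans_eq (Fintype.card_fin Nh)
  have hPpow : (∏ j, ‖η j‖) ^ Nh = (∏ j, ‖η j‖) ^ (Nh - n) * (∏ j, ‖η j‖) ^ n := by
    rw [← pow_add, Nat.sub_add_cancel hn]
  rw [Finset.prod_mul_distrib, Finset.prod_const, Finset.prod_inv_distrib,
    Finset.prod_pow_eq_pow_sum, Finset.prod_pow_eq_pow_sum, card_univ, Fintype.card_fin,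
    zpow_sub₀ hμ.ne', zpow_neg, ← Nat.cast_sum, ← Nat.cast_sum, zpow_natCast, zpow_natCast,
    ← Nat.cast_mul, zpow_natCast, pow_mul, pow_mul,
    hPpow, mul_pow, mul_pow, inv_pow, inv_pow]
  field_simp
  ring

end
end

section
/- Fix g*, N̂ ∈ ℕ, a compact domain D ⊂ ℂ, and z ∈ D. Let T̂ be the N̂×N̂ upper-triangular Toeplitz matrix with symbol p̂_z(τ) = ∑_{j=0}^{g*} â_{−j}(z) τ^{−j}, where â₀(z) ≠ 0 and â_{−g*}(z) = 1 for all z ∈ D; equivalently T̂ = ∏_{j=1}^{g*} (J_{N̂} − η̂_j(z) I_{N̂}), where {η̂_j(z)}_{j=1}^{g*} are the roots of p̂_z(·) = 0. If 𝔛 = {𝔵₁ < … < 𝔵_n} ⊂ [N̂] and 𝔜 = {𝔶₁ < … < 𝔶_n} ⊂ [N̂] are such that either there exists i ∈ [n] with 𝔵_i < 𝔶_i, or there exists i ∈ [n − g*] with 𝔵_i ≥ 𝔶_{i+g*}, then det(T̂[𝔛^∁; 𝔜^∁]) = 0. -/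
/-!
Vanishing of minors of banded upper-triangular Toeplitz matrices
(Lemma `lem:toep-minor-0`).
-/

open Finset
open scoped Classical

noncomputable section

/-- A square matrix vanishing on `R × Cᶜ` with `|C| < |R|` is singular. -/
theorem Matrix.det_eq_zero_of_zero_block {ι : Type*} [Fintype ι] [DecidableEq ι]
    (M : Matrix ι ι ℂ) (R C : Finset ι) (hcard : C.card < R.card)
    (hM : ∀ i ∈ R, ∀ j ∉ C, M i j = 0) : M.det = 0 := by
  rw [← Matrix.det_transpose, Matrix.det_apply]
  refine Finset.sum_eq_zero fun σ _ => ?_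
  obtain ⟨i, hi, hiC⟩ : ∃ i ∈ R, σ i ∉ C := by
    by_contra! h
    exact absurd (Finset.card_le_card_of_injOn σ h σ.injective.injOn) (by omega)
  rw [Finset.prod_eq_zero (Finset.mem_univ i) (by simpa using hM i hi _ hiC), smul_zero]

/-- The number of indices whose image under the increasing enumeration of `S` lies in `R`. -/
theorem card_filter_orderIsoOfFin {N k : ℕ} (S R : Finset (Fin N)) (h : S.card = k) :
    (univ.filter fun i : Fin k => (S.orderIsoOfFin h i : Fin N) ∈ R).card = (R ∩ S).card := by
  refine Finset.card_bij (fun i _ => (S.orderIsoOfFin h i : Fin N)) ?_ ?_ ?_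
  · intro i hi
    simp only [Finset.mem_filter, Finset.mem_univ, true_and] at hi
    exact Finset.mem_inter.2 ⟨hi, (S.orderIsoOfFin h i).2⟩
  · intro i _ j _ hij
    exact (S.orderIsoOfFin h).injective (Subtype.ext hij)
  · intro a ha
    rw [Finset.mem_inter] at ha
    obtain ⟨i, hi⟩ := (S.orderIsoOfFin h).surjective ⟨a, ha.2⟩
    exact ⟨i, Finset.mem_filter.2 ⟨Finset.mem_univ i, by rw [hi]; exact ha.1⟩, by rw [hi]⟩

theorem minorDet_eq_zero_of_zero_block {N : ℕ} (A : Matrix (Fin N) (Fin N) ℂ)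
    (X Y R C : Finset (Fin N)) (hcard : (C ∩ Y).card < (R ∩ X).card)
    (hA : ∀ a ∈ R, ∀ b ∉ C, A a b = 0) : minorDet A X Y = 0 := by
  unfold minorDet
  split_ifs with h
  · refine Matrix.det_eq_zero_of_zero_block _
      (univ.filter fun i => (X.orderIsoOfFin rfl i : Fin N) ∈ R)
      (univ.filter fun j => (Y.orderIsoOfFin h j : Fin N) ∈ C) ?_ ?_
    · rwa [card_filter_orderIsoOfFin, card_filter_orderIsoOfFin]
    · intro i hi j hj
      simp only [Finset.mem_filter, Finset.mem_univ, true_and] at hi hj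
      exact hA _ hi _ hj
  · rfl

/-- A product of `m` matrices `J - c I` is upper triangular with bandwidth `m`. -/
theorem prod_jordanM_sub_smul_apply_eq_zero {N : ℕ} (l : List ℂ) (a b : Fin N)
    (hab : (b : ℕ) < a ∨ (a : ℕ) + l.length < b) :
    (l.map fun c => jordanM N - c • (1 : Matrix (Fin N) (Fin N) ℂ)).prod a b = 0 := by
  induction l generalizing a with
  | nil =>
    have : a ≠ b := by rintro rfl; simp at hab
    simp [this]
  | cons c l ih =>
    simp only [List.length_cons] at hab
    rw [List.map_cons, List.prod_cons, Matrix.mul_apply]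
    refine Finset.sum_eq_zero fun k _ => ?_
    by_cases hk : (b : ℕ) < k ∨ (k : ℕ) + l.length < b
    · rw [ih k hk, mul_zero]
    · have h1 : a ≠ k := by rintro rfl; omega
      have h2 : ¬ (a : ℕ) + 1 = k := by omega
      simp [jordanM, h1, h2]

theorem toepFromRoots_apply_eq_zero {N g : ℕ} (η : Fin g → ℂ) (a b : Fin N)
    (hab : (b : ℕ) < a ∨ (a : ℕ) + g < b) : toepFromRoots N g η a b = 0 := by
  have := prod_jordanM_sub_smul_apply_eq_zero ((List.finRange g).map η) a b (by simpa using hab)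
  rwa [List.map_map] at this

/-- **Lemma (vanishing of Toeplitz minors).** If for some `i ∈ [n]` one has `𝔵_i < 𝔶_i`,
or for some `i ∈ [n - g⋆]` one has `𝔵_i ≥ 𝔶_{i+g⋆}`, then `det T̂[𝔛^∁; 𝔜^∁] = 0`. -/
theorem toeplitz_minor_vanishes
    (gs Nh : ℕ) (hgs : 0 < gs) (hNh : 0 < Nh)
    (D : Set ℂ) (hD : IsCompact D) (z : ℂ) (hz : z ∈ D)
    (ηh : ℂ → Fin gs → ℂ)
    (hroots : ∀ w ∈ D, ∀ j, ηh w j ≠ 0)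
    (n : ℕ) (X Y : Finset (Fin Nh)) (hX : X.card = n) (hY : Y.card = n)
    (hfail : (∃ i : Fin n, (X.orderIsoOfFin hX i : Fin Nh) < (Y.orderIsoOfFin hY i : Fin Nh)) ∨
      (∃ i : Fin n, ∃ h : (i : ℕ) + gs < n,
        (Y.orderIsoOfFin hY ⟨(i : ℕ) + gs, h⟩ : Fin Nh) ≤ (X.orderIsoOfFin hX i : Fin Nh))) :
    minorDet (toepFromRoots Nh gs (ηh z)) Xᶜ Yᶜ = 0 := by
  have split : ∀ R S : Finset (Fin Nh), (R ∩ Sᶜ).card + (R ∩ S).card = R.card := fun R S => by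
    rw [← Finset.sdiff_eq_inter_compl, Finset.card_sdiff_add_card_inter]
  have monoX := (X.orderIsoOfFin hX).strictMono
  have monoY := (Y.orderIsoOfFin hY).strictMono
  rcases hfail with ⟨i, hi⟩ | ⟨i, h, hi⟩
  · set c : Fin Nh := (X.orderIsoOfFin hX i).val
    have hXc : (Ioi c ∩ X).card ≤ (Ioi i).card := by
      rw [← card_filter_orderIsoOfFin X _ hX]
      refine Finset.card_le_card fun k hk => ?_
      simp only [Finset.mem_filter, Finset.mem_univ, true_and, Finset.mem_Ioi] at hk ⊢
      exact monoX.lt_iff_lt.1 hk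
    have hYc : (Ici i).card ≤ (Ioi c ∩ Y).card := by
      rw [← card_filter_orderIsoOfFin Y _ hY]
      refine Finset.card_le_card fun k hk => ?_
      simp only [Finset.mem_filter, Finset.mem_univ, true_and, Finset.mem_Ioi,
        Finset.mem_Ici] at hk ⊢
      exact hi.trans_le (monoY.monotone hk)
    refine minorDet_eq_zero_of_zero_block _ _ _ (Ioi c) (Ioi c) ?_ ?_
    · have h1 := split (Ioi c) X
      have h2 := split (Ioi c) Y
      have := i.2
      rw [Fin.card_Ioi] at hXc
      rw [Fin.card_Ici] at hYc
      omega
    · intro a ha b hb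
      rw [Finset.mem_Ioi] at ha hb
      exact toepFromRoots_apply_eq_zero _ _ _ (Or.inl (by omega))
  · set d : Fin Nh := (Y.orderIsoOfFin hY ⟨i + gs, h⟩).val
    have hYd : (Iic (⟨i + gs, h⟩ : Fin n)).card ≤ (Iic d ∩ Y).card := by
      rw [← card_filter_orderIsoOfFin Y _ hY]
      refine Finset.card_le_card fun k hk => ?_
      simp only [Finset.mem_filter, Finset.mem_univ, true_and, Finset.mem_Iic] at hk ⊢
      exact monoY.monotone hk
    rw [Fin.card_Iic] at hYd
    have h2 := split (Iic d) Y
    rw [Fin.card_Iic] at h2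
    simp only at hYd
    obtain ⟨r, hr⟩ : ∃ r : Fin Nh, (r : ℕ) + gs = d := ⟨⟨d - gs, by omega⟩, by simp; omega⟩
    have hXr : (Iic r ∩ X).card ≤ (Iio i).card := by
      rw [← card_filter_orderIsoOfFin X _ hX]
      refine Finset.card_le_card fun k hk => ?_
      simp only [Finset.mem_filter, Finset.mem_univ, true_and, Finset.mem_Iic,
        Finset.mem_Iio] at hk ⊢
      have hrd : r < d := Fin.lt_def.2 (by omega)
      exact monoX.lt_iff_lt.1 (Subtype.coe_lt_coe.1 (hk.trans_lt (hrd.trans_le hi)))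
    rw [Fin.card_Iio] at hXr
    have h1 := split (Iic r) X
    rw [Fin.card_Iic] at h1
    refine minorDet_eq_zero_of_zero_block _ _ _ (Iic r) (Iic d) (by omega) ?_
    intro a ha b hb
    rw [Finset.mem_Iic] at ha hb
    exact toepFromRoots_apply_eq_zero _ _ _ (Or.inr (by omega))

end
end

section
/- Let Ω' ⋐ ℂ be a nonempty open relatively compact set, and for each N ∈ ℕ let Ω_N ⋐ Ω' be a nonempty open relatively compact set. Let q_z(ζ) = ∑_{n=−𝔑_-}^{𝔑_+} q_{z,n} ζ^{−n}, z ∈ Ω', be a family of Laurent polynomials with 𝔑_± ≥ 0 fixed (and 𝔑_± > 0 whenever 𝔑_∓ = 0). Suppose: (i) there is C < ∞ with q_{z,𝔑_+} ≠ 0, |q_{z,−𝔑_-}| ≥ 1/C, and |q_{z,n}| ≤ C for all z ∈ Ω' and all n; (ii) all roots of q_z are simple for all z ∈ Ω'; (iii) there is C < ∞ with |ζ − ω| ≥ 1/C for any two distinct roots ζ, ω of q_z, and 0 < |ζ| ≤ C for every root ζ, for all z ∈ Ω'; (iv) 0 ∉ q_z(S¹) and there is C₀ > 0 with ||ζ|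 − 1| ≥ C₀ log N/N for every root ζ, for all large N and all z ∈ Ω_N; (v) there are m₀ ≥ 0 and C₁ > 1, C₂ > 0 such that for all large N and all z ∈ Ω_N, the roots of q_z inside D(0,1), of total number m_{z,+} ≥ m₀ and ordered by non-decreasing modulus as ζ⁺_1,…,ζ⁺_{m_{z,+}}, satisfy |ζ⁺_{m_{z,+}−m₀}| < 1/C₁ < 1 − C₂ log N/N ≤ |ζ⁺_{m_{z,+}−m₀+1}| ≤ … ≤ |ζ⁺_{m_{z,+}}|; and (vi) there is m̂₀ ∈ {0, m₀} with ind_{q_z(S¹)}(0) = m̂₀ for all N and all z ∈ Ω_N. Then there is a constant C̃ < ∞ such that for all large N and all z ∈ Ω_N, the N×N Toeplitz matrix P_N(q_z) is invertible and ‖P_N(q_z)^{−1}‖ ≤ C̃ · N^{1 + C₂·Θ(m̂₀)} / log N, where Θ is the Heaviside function (Θ(x) = 1 for x > 0 and Θ(x) = 0 for x ≤ 0). -/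
/-!
Resolvent estimate for families of banded Toeplitz matrices close to the spectral curve
(Theorem `thm:resBound`).
-/

open Filter Finset
open scoped Classical

noncomputable section

/-- The Laurent polynomial `q_z(ζ) = ∑_{n=-𝔑₋}^{𝔑₊} q_{z,n} ζ^{-n}`. -/
def qFun (np nm : ℕ) (q : ℂ → ℤ → ℂ) (z ζ : ℂ) : ℂ :=
  ∑ n ∈ Finset.Icc (-(nm : ℤ)) (np : ℤ), q z n * ζ ^ (-n)

/-- The polynomial `ζ^{𝔑₊} q_z(ζ)`, whose roots are the roots of `q_z`. -/
def qPoly (np nm : ℕ) (q : ℂ → ℤ → ℂ) (z : ℂ) : Polynomial ℂ :=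
  ∑ n ∈ Finset.Icc (-(nm : ℤ)) (np : ℤ),
    Polynomial.C (q z n) * Polynomial.X ^ (((np : ℤ) - n).toNat)

/-- The `N × N` Toeplitz matrix `P_N(q_z)` with entries `q_{z, i-j}`. -/
def toepQ (q : ℂ → ℤ → ℂ) (z : ℂ) (N : ℕ) : Matrix (Fin N) (Fin N) ℂ :=
  Matrix.of fun i j => q z ((i : ℤ) - (j : ℤ))

/-- The `ℓ²` norm of a vector in `ℂ^N`. -/
def l2norm {N : ℕ} (v : Fin N → ℂ) : ℝ := Real.sqrt (∑ i, ‖v i‖ ^ 2)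

/-- The Heaviside function on `ℕ`. -/
def thetaH (n : ℕ) : ℝ := if n = 0 then 0 else 1

/-- Coefficients of a polynomial of degree `< n` are controlled by its values at `n` bounded,
separated nodes. -/
theorem exists_coeff_le_of_eval_le (R : ℝ) (hR : 0 < R) (n : ℕ) :
    ∃ K : ℝ, 0 ≤ K ∧ ∀ s : Finset ℂ, s.card = n → (∀ x ∈ s, ‖x‖ ≤ R) →
      (∀ x ∈ s, ∀ y ∈ s, x ≠ y → 1 / R ≤ ‖x - y‖) →
      ∀ E : Polynomial ℂ, E.degree < n → ∀ Y : ℝ, 0 ≤ Y →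
        (∀ x ∈ s, ‖E.eval x‖ ≤ Y) → ∀ m, ‖E.coeff m‖ ≤ K * Y := by
  induction n with
  | zero =>
    refine ⟨0, le_rfl, fun s _ _ _ E hE Y _ _ m => ?_⟩
    have : E = 0 := by
      rw [← Polynomial.degree_eq_bot]
      simpa using hE
    simp [this]
  | succ n ih =>
    obtain ⟨K, hK0, hK⟩ := ih
    refine ⟨1 + (1 + R) * (K * (R * 2)), by positivity, fun s hs hsR hsep E hE Y hY hEY m => ?_⟩
    obtain ⟨x₀, hx₀⟩ : s.Nonempty := by
      rw [← Finset.card_pos]; omega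
    set E₁ := E /ₘ (Polynomial.X - Polynomial.C x₀) with hE₁
    have hdiv : E = Polynomial.C (E.eval x₀) + (Polynomial.X - Polynomial.C x₀) * E₁ := by
      conv_lhs => rw [← Polynomial.modByMonic_add_div E (Polynomial.X - Polynomial.C x₀)]
      rw [Polynomial.modByMonic_X_sub_C_eq_C_eval]
    have hdeg : E₁.degree < n := by
      rw [Polynomial.degree_lt_iff_coeff_zero] at hE ⊢
      intro k hk
      rw [hE₁, Polynomial.coeff_divByMonic_X_sub_C]
      refine Finset.sum_eq_zero fun i hi => ?_
      rw [hE i (by have := (Finset.mem_Icc.1 hi).1; omega), mul_zero]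
    have hval : ∀ x ∈ s.erase x₀, ‖E₁.eval x‖ ≤ R * 2 * Y := by
      intro x hx
      obtain ⟨hne, hxs⟩ := Finset.mem_erase.1 hx
      have hev : E.eval x - E.eval x₀ = (x - x₀) * E₁.eval x := by
        conv_lhs => lhs; rw [hdiv]
        simp
      have h1 : ‖x - x₀‖ * ‖E₁.eval x‖ ≤ 2 * Y := by
        rw [← norm_mul, ← hev]
        have := norm_sub_le (E.eval x) (E.eval x₀)
        linarith [hEY x hxs, hEY x₀ hx₀]
      have h2 := mul_le_mul_of_nonneg_right (hsep x hxs x₀ hx₀ hne) (norm_nonneg (E₁.eval x))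
      have h3 := h2.trans h1
      rw [one_div, inv_mul_le_iff₀ hR] at h3
      linarith
    have hco : ∀ k, ‖E₁.coeff k‖ ≤ K * (R * 2) * Y := by
      intro k
      rw [mul_assoc]
      exact hK (s.erase x₀) (by rw [Finset.card_erase_of_mem hx₀]; omega)
        (fun x hx => hsR x (Finset.mem_of_mem_erase hx))
        (fun x hx y hy => hsep x (Finset.mem_of_mem_erase hx) y (Finset.mem_of_mem_erase hy))
        E₁ hdeg (R * 2 * Y) (by positivity) hval k
    have hpos : 0 ≤ K * (R * 2) * Y := by positivity
    have hx₀R := hsR x₀ hx₀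
    have hmul : ∀ k, ‖x₀ * E₁.coeff k‖ ≤ R * (K * (R * 2) * Y) := by
      intro k
      rw [norm_mul]
      gcongr
      exact hco k
    rw [hdiv, sub_mul]
    cases m with
    | zero =>
      simp only [Polynomial.coeff_add, Polynomial.coeff_sub, Polynomial.coeff_C_mul,
        Polynomial.coeff_C_zero, Polynomial.coeff_X_mul_zero, zero_sub]
      refine (norm_add_le _ _).trans ?_
      rw [norm_neg]
      linarith [hmul 0, hEY x₀ hx₀]
    | succ m =>
      simp only [Polynomial.coeff_add, Polynomial.coeff_sub, Polynomial.coeff_C_mul,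
        Polynomial.coeff_C_succ, Polynomial.coeff_X_mul, zero_add]
      refine (norm_sub_le _ _).trans ?_
      linarith [hmul (m + 1), hco m]

/-- Sequence form of `exists_coeff_le_of_eval_le`, bounding the `ℓ¹` norm of the coefficients. -/
theorem exists_sum_coeff_le_of_eval_le (R : ℝ) (hR : 0 < R) (n : ℕ) :
    ∃ K : ℝ, 0 ≤ K ∧ ∀ s : Finset ℂ, s.card = n → (∀ x ∈ s, ‖x‖ ≤ R) →
      (∀ x ∈ s, ∀ y ∈ s, x ≠ y → 1 / R ≤ ‖x - y‖) →
      ∀ e : ℕ → ℂ, ∀ Y : ℝ, 0 ≤ Y →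
        (∀ x ∈ s, ‖∑ i ∈ range n, e i * x ^ i‖ ≤ Y) → ∑ i ∈ range n, ‖e i‖ ≤ K * Y := by
  obtain ⟨K, hK0, hK⟩ := exists_coeff_le_of_eval_le R hR n
  refine ⟨n * K, by positivity, fun s hs hsR hsep e Y hY he => ?_⟩
  set E : Polynomial ℂ := ∑ i ∈ range n, Polynomial.C (e i) * Polynomial.X ^ i with hE
  have hcoeff : ∀ m, E.coeff m = if m < n then e m else 0 := by
    intro m
    simp [hE, Polynomial.coeff_X_pow]
  have hdeg : E.degree < n := by
    rw [Polynomial.degree_lt_iff_coeff_zero]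
    intro m hm
    rw [hcoeff, if_neg (by omega)]
  have key := hK s hs hsR hsep E hdeg Y hY (fun x hx => by
    simpa [hE, Polynomial.eval_finsetSum] using he x hx)
  calc ∑ i ∈ range n, ‖e i‖ ≤ ∑ _i ∈ range n, K * Y := by
        refine Finset.sum_le_sum fun i hi => ?_
        have := key i
        rwa [hcoeff, if_pos (Finset.mem_range.1 hi)] at this
    _ = n * K * Y := by simp [mul_assoc]

/-- Partial fraction decomposition of `Φ / p` for `Φ = p * U`. -/
theorem eq_sum_divByMonic (s : Finset ℂ) (hs : s.Nonempty) (c : ℂ) (hc : c ≠ 0)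
    (p U : Polynomial ℂ)
    (hp : p = Polynomial.C c * ∏ r ∈ s, (Polynomial.X - Polynomial.C r)) :
    U = ∑ r ∈ s, Polynomial.C (c * ∏ r' ∈ s.erase r, (r - r'))⁻¹ *
      ((p * U) /ₘ (Polynomial.X - Polynomial.C r)) := by
  have hV : ∀ r ∈ s, (p * U) /ₘ (Polynomial.X - Polynomial.C r) =
      Polynomial.C c * (∏ r' ∈ s.erase r, (Polynomial.X - Polynomial.C r')) * U := by
    intro r hr
    have : p * U = (Polynomial.X - Polynomial.C r) *
        (Polynomial.C c * (∏ r' ∈ s.erase r, (Polynomial.X - Polynomial.C r')) * U) := by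
      rw [hp, ← Finset.mul_prod_erase s _ hr]
      ring
    rw [this, Polynomial.mul_divByMonic_cancel_left _ (Polynomial.monic_X_sub_C r)]
  have hL := Lagrange.sum_basis (s := s) (v := fun r : ℂ => r) (Set.injOn_id _) hs
  calc U = (∑ r ∈ s, Lagrange.basis s (fun r : ℂ => r) r) * U := by rw [hL, one_mul]
    _ = _ := by
      rw [Finset.sum_mul]
      refine Finset.sum_congr rfl fun r hr => ?_
      rw [hV r hr, Lagrange.basis]
      simp only [Lagrange.basisDivisor, Finset.prod_mul_distrib]
      rw [mul_inv, Polynomial.C_mul, ← map_prod, Finset.prod_inv_distrib]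
      have : Polynomial.C c⁻¹ * Polynomial.C c = 1 := by
        rw [← Polynomial.C_mul, inv_mul_cancel₀ hc, Polynomial.C_1]
      linear_combination (-(Polynomial.C (∏ r' ∈ s.erase r, (r - r'))⁻¹ *
        (∏ r' ∈ s.erase r, (Polynomial.X - Polynomial.C r')) * U)) * this

/-- Coefficients of the quotient by `X - r` at a root `r`, summed from below. -/
theorem coeff_divByMonic_X_sub_C_of_isRoot (Φ : Polynomial ℂ) (r : ℂ) (hr : r ≠ 0)
    (hΦ : Φ.eval r = 0) (k : ℕ) :
    (Φ /ₘ (Polynomial.X - Polynomial.C r)).coeff k =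
      -∑ m ∈ range (k + 1), (r⁻¹) ^ (k + 1 - m) * Φ.coeff m := by
  set V := Φ /ₘ (Polynomial.X - Polynomial.C r) with hV
  have hmul : Φ = Polynomial.X * V - Polynomial.C r * V := by
    rw [← sub_mul]
    conv_lhs => rw [← Polynomial.modByMonic_add_div Φ (Polynomial.X - Polynomial.C r)]
    rw [Polynomial.modByMonic_X_sub_C_eq_C_eval, hΦ]
    simp [hV]
  induction k with
  | zero =>
    have h0 : Φ.coeff 0 = -(r * V.coeff 0) := by
      conv_lhs => rw [hmul]
      simp
    rw [Finset.sum_range_one, h0, show 0 + 1 - 0 = 1 from rfl, pow_one]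
    field_simp
  | succ k ih =>
    have h1 : Φ.coeff (k + 1) = V.coeff k - r * V.coeff (k + 1) := by
      conv_lhs => rw [hmul]
      simp
    have h2 : ∑ m ∈ range (k + 1), (r⁻¹) ^ (k + 1 + 1 - m) * Φ.coeff m =
        r⁻¹ * ∑ m ∈ range (k + 1), (r⁻¹) ^ (k + 1 - m) * Φ.coeff m := by
      rw [Finset.mul_sum]
      refine Finset.sum_congr rfl fun m hm => ?_
      have : k + 1 + 1 - m = (k + 1 - m) + 1 := by have := Finset.mem_range.1 hm; omega
      rw [this, pow_succ]
      ring
    rw [Finset.sum_range_succ, h2, h1]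
    rw [show k + 1 + 1 - (k + 1) = 1 by omega, pow_one]
    have h3 : ∑ m ∈ range (k + 1), (r⁻¹) ^ (k + 1 - m) * Φ.coeff m = -V.coeff k := by
      rw [ih, neg_neg]
    rw [h3]
    field_simp
    ring

/-- Majorant of the fundamental solution: decay rate `ρ` above the diagonal, `σ` below. -/
def greenKernel (ρ σ : ℝ) (k m : ℕ) : ℝ :=
  if k < m then ρ ^ (m - (k + 1)) else σ ^ (k + 1 - m)

theorem greenKernel_nonneg {ρ σ : ℝ} (hρ : 0 ≤ ρ) (hσ : 0 ≤ σ) (k m : ℕ) :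
    0 ≤ greenKernel ρ σ k m := by
  unfold greenKernel
  split_ifs <;> positivity

theorem greenKernel_sq (ρ σ : ℝ) (k m : ℕ) :
    greenKernel ρ σ k m ^ 2 = greenKernel (ρ ^ 2) (σ ^ 2) k m := by
  unfold greenKernel
  split_ifs <;> rw [← pow_mul, ← pow_mul, mul_comm]

theorem sum_pow_le_of_injOn {ι : Type*} (s : Finset ι) (g : ι → ℕ) {ρ : ℝ} (hρ : 0 ≤ ρ) (L : ℕ)
    (hg : Set.InjOn g s) (hL : ∀ i ∈ s, g i < L) :
    ∑ i ∈ s, ρ ^ g i ≤ ∑ i ∈ range L, ρ ^ i := by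
  rw [← Finset.sum_image (f := fun j => ρ ^ j) hg]
  refine Finset.sum_le_sum_of_subset_of_nonneg ?_ fun i _ _ => by positivity
  intro j hj
  obtain ⟨i, hi, rfl⟩ := Finset.mem_image.1 hj
  exact Finset.mem_range.2 (hL i hi)

theorem sum_greenKernel_left_le {ρ σ : ℝ} (hρ : 0 ≤ ρ) (hσ : 0 ≤ σ) (N m L L' : ℕ)
    (hm : m ≤ L) (hN : N < L') :
    ∑ k ∈ range N, greenKernel ρ σ k m ≤ ∑ i ∈ range L, ρ ^ i + ∑ i ∈ range L', σ ^ i := by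
  unfold greenKernel
  rw [Finset.sum_ite]
  refine add_le_add (sum_pow_le_of_injOn _ _ hρ L ?_ ?_) (sum_pow_le_of_injOn _ _ hσ L' ?_ ?_)
  · intro x hx y hy h
    simp at hx hy h
    omega
  · intro x hx
    simp at hx
    omega
  · intro x hx y hy h
    simp at hx hy h
    omega
  · intro x hx
    simp at hx
    omega

theorem sum_greenKernel_right_le {ρ σ : ℝ} (hρ : 0 ≤ ρ) (hσ : 0 ≤ σ) (k a N L L' : ℕ)
    (hL : a + N ≤ L) (hk : k + 1 < L') :
    ∑ j ∈ range N, greenKernel ρ σ k (a + j) ≤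
      ∑ i ∈ range L, ρ ^ i + ∑ i ∈ range L', σ ^ i := by
  unfold greenKernel
  rw [Finset.sum_ite]
  refine add_le_add (sum_pow_le_of_injOn _ _ hρ L ?_ ?_) (sum_pow_le_of_injOn _ _ hσ L' ?_ ?_)
  · intro x hx y hy h
    simp at hx hy h
    omega
  · intro x hx
    simp at hx
    omega
  · intro x hx y hy h
    simp at hx hy h
    omega
  · intro x hx
    simp at hx
    omega

theorem sum_greenKernel_above_le {ρ σ : ℝ} (hρ : 0 ≤ ρ) (N m L : ℕ)
    (hm : m ≤ L) (hN : N ≤ m) :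
    ∑ k ∈ range N, greenKernel ρ σ k m ≤ ∑ i ∈ range L, ρ ^ i := by
  have : ∀ k ∈ range N, greenKernel ρ σ k m = ρ ^ (m - (k + 1)) := by
    intro k hk
    rw [greenKernel, if_pos (by simp at hk; omega)]
  rw [Finset.sum_congr rfl this]
  refine sum_pow_le_of_injOn _ _ hρ L ?_ ?_
  · intro x hx y hy h
    simp at hx hy h
    omega
  · intro x hx
    simp at hx
    omega

/-- Weighted Cauchy-Schwarz inequality. -/
theorem sum_mul_sq_le {ι : Type*} (s : Finset ι) (w h : ι → ℝ) (hw : ∀ i ∈ s, 0 ≤ w i) :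
    (∑ i ∈ s, w i * h i) ^ 2 ≤ (∑ i ∈ s, w i) * ∑ i ∈ s, w i * h i ^ 2 :=
  Finset.sum_sq_le_sum_mul_sum_of_sq_le_mul s hw
    (fun i hi => mul_nonneg (hw i hi) (sq_nonneg _)) (fun i _ => le_of_eq (by ring))

/-- Schur test. -/
theorem sum_sq_kernel_le {ι κ : Type*} (s : Finset ι) (t : Finset κ) (h : ι → κ → ℝ)
    (hh : ∀ i ∈ s, ∀ j ∈ t, 0 ≤ h i j) (D : ℝ) (hD : 0 ≤ D)
    (hrow : ∀ i ∈ s, ∑ j ∈ t, h i j ≤ D) (hcol : ∀ j ∈ t, ∑ i ∈ s, h i j ≤ D) (f : κ → ℝ) :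
    ∑ i ∈ s, (∑ j ∈ t, h i j * f j) ^ 2 ≤ D ^ 2 * ∑ j ∈ t, f j ^ 2 := by
  calc ∑ i ∈ s, (∑ j ∈ t, h i j * f j) ^ 2
      ≤ ∑ i ∈ s, D * ∑ j ∈ t, h i j * f j ^ 2 := by
        refine Finset.sum_le_sum fun i hi => (sum_mul_sq_le t (h i) f (hh i hi)).trans ?_
        exact mul_le_mul_of_nonneg_right (hrow i hi)
          (Finset.sum_nonneg fun j hj => mul_nonneg (hh i hi j hj) (sq_nonneg _))
    _ = D * ∑ j ∈ t, (∑ i ∈ s, h i j) * f j ^ 2 := by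
        rw [← Finset.mul_sum, Finset.sum_comm]
        simp_rw [Finset.sum_mul]
    _ ≤ D * ∑ j ∈ t, D * f j ^ 2 := by
        gcongr with j hj
        exact hcol j hj
    _ = D ^ 2 * ∑ j ∈ t, f j ^ 2 := by
        rw [← Finset.mul_sum]; ring

/-- A kernel whose columns have square norm at most `Q` maps `ℓ¹` to `ℓ²`. -/
theorem sum_sq_kernel_le_of_col {ι κ : Type*} (s : Finset ι) (t : Finset κ) (h : ι → κ → ℝ)
    (Q : ℝ) (hcol : ∀ j ∈ t, ∑ i ∈ s, h i j ^ 2 ≤ Q) (e : κ → ℝ) (he : ∀ j ∈ t, 0 ≤ e j) :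
    ∑ i ∈ s, (∑ j ∈ t, h i j * e j) ^ 2 ≤ Q * (∑ j ∈ t, e j) ^ 2 := by
  have he' : 0 ≤ ∑ j ∈ t, e j := Finset.sum_nonneg he
  calc ∑ i ∈ s, (∑ j ∈ t, h i j * e j) ^ 2
      ≤ ∑ i ∈ s, (∑ j ∈ t, e j) * ∑ j ∈ t, e j * h i j ^ 2 := by
        refine Finset.sum_le_sum fun i _ => ?_
        have := sum_mul_sq_le t e (h i) he
        simpa only [mul_comm (h i _)] using this
    _ = (∑ j ∈ t, e j) * ∑ j ∈ t, e j * ∑ i ∈ s, h i j ^ 2 := by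
        rw [← Finset.mul_sum, Finset.sum_comm]
        simp_rw [Finset.mul_sum]
    _ ≤ (∑ j ∈ t, e j) * ∑ j ∈ t, e j * Q := by
        gcongr with j hj
        · exact he j hj
        · exact hcol j hj
    _ = Q * (∑ j ∈ t, e j) ^ 2 := by
        rw [← Finset.sum_mul]; ring

/-- Pointwise bound on the coefficients of `U` in terms of those of `p * U`. -/
theorem norm_coeff_le_sum_greenKernel (R : ℝ) (hR : 0 < R) (sA sB : Finset ℂ)
    (hne : (sA ∪ sB).Nonempty)
    (hsep : ∀ x ∈ sA ∪ sB, ∀ y ∈ sA ∪ sB, x ≠ y → 1 / R ≤ ‖x - y‖) (c : ℂ) (hc : 1 / R ≤ ‖c‖)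
    (p U : Polynomial ℂ)
    (hp : p = Polynomial.C c * ∏ r ∈ sA ∪ sB, (Polynomial.X - Polynomial.C r))
    (ρ σ : ℝ) (hρ : 0 ≤ ρ) (hσ : 0 ≤ σ) (hA : ∀ r ∈ sA, ‖r‖ ≤ ρ)
    (hB : ∀ r ∈ sB, r ≠ 0 ∧ ‖r‖⁻¹ ≤ σ) (L k : ℕ) (hL : (p * U).natDegree < L) (hk : k < L) :
    ‖U.coeff k‖ ≤ (sA ∪ sB).card * R ^ (sA ∪ sB).card *
      ∑ m ∈ range L, greenKernel ρ σ k m * ‖(p * U).coeff m‖ := by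
  have hc0 : c ≠ 0 := by
    rintro rfl
    rw [norm_zero] at hc
    have : 0 < 1 / R := by positivity
    linarith
  set Φ := p * U with hΦ
  set H := ∑ m ∈ range L, greenKernel ρ σ k m * ‖Φ.coeff m‖ with hH
  have hH0 : 0 ≤ H :=
    Finset.sum_nonneg fun m _ => mul_nonneg (greenKernel_nonneg hρ hσ k m) (norm_nonneg _)
  have hV : ∀ r ∈ sA ∪ sB, ‖(Φ /ₘ (Polynomial.X - Polynomial.C r)).coeff k‖ ≤ H := by
    intro r hr
    rcases Finset.mem_union.1 hr with h | h
    · rw [Polynomial.coeff_divByMonic_X_sub_C]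
      calc _ ≤ ∑ m ∈ Finset.Icc (k + 1) Φ.natDegree, greenKernel ρ σ k m * ‖Φ.coeff m‖ := by
            refine norm_sum_le_of_le _ fun m hm => ?_
            rw [greenKernel, if_pos (by have := (Finset.mem_Icc.1 hm).1; omega), norm_mul,
              norm_pow]
            gcongr
            exact hA r h
        _ ≤ H := by
            refine Finset.sum_le_sum_of_subset_of_nonneg ?_ fun m _ _ =>
              mul_nonneg (greenKernel_nonneg hρ hσ k m) (norm_nonneg _)
            intro m hm
            have := (Finset.mem_Icc.1 hm).2
            exact Finset.mem_range.2 (by omega)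
    · have hroot : Φ.eval r = 0 := by
        rw [hΦ, hp, Polynomial.eval_mul, Polynomial.eval_mul, Polynomial.eval_prod,
          Finset.prod_eq_zero hr (by simp)]
        simp
      rw [coeff_divByMonic_X_sub_C_of_isRoot Φ r (hB r h).1 hroot, norm_neg]
      calc _ ≤ ∑ m ∈ range (k + 1), greenKernel ρ σ k m * ‖Φ.coeff m‖ := by
            refine norm_sum_le_of_le _ fun m hm => ?_
            rw [greenKernel, if_neg (by have := Finset.mem_range.1 hm; omega), norm_mul,
              norm_pow, norm_inv]
            gcongr
            exact (hB r h).2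
        _ ≤ H := by
            refine Finset.sum_le_sum_of_subset_of_nonneg ?_ fun m _ _ =>
              mul_nonneg (greenKernel_nonneg hρ hσ k m) (norm_nonneg _)
            exact Finset.range_subset_range.2 (by omega)
  have hγ : ∀ r ∈ sA ∪ sB, ‖(c * ∏ r' ∈ (sA ∪ sB).erase r, (r - r'))⁻¹‖ ≤
      R ^ (sA ∪ sB).card := by
    intro r hr
    rw [norm_inv, norm_mul, norm_prod, ← inv_inv (R ^ _)]
    refine inv_anti₀ (by positivity) ?_
    have hcard : (sA ∪ sB).card = ((sA ∪ sB).erase r).card + 1 :=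
      (Finset.card_erase_add_one hr).symm
    rw [hcard, pow_succ', mul_inv, ← inv_pow, ← one_div]
    refine mul_le_mul hc ?_ (by positivity) (norm_nonneg _)
    rw [← Finset.prod_const]
    refine Finset.prod_le_prod (fun _ _ => by positivity) fun r' hr' => ?_
    exact hsep r hr r' (Finset.mem_of_mem_erase hr') (Finset.ne_of_mem_erase hr').symm
  have hU := congrArg (fun P : Polynomial ℂ => P.coeff k)
    (eq_sum_divByMonic (sA ∪ sB) hne c hc0 p U hp)
  simp only [Polynomial.finsetSum_coeff, Polynomial.coeff_C_mul] at hU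
  rw [hU]
  calc _ ≤ ∑ _r ∈ sA ∪ sB, R ^ (sA ∪ sB).card * H := by
        refine norm_sum_le_of_le _ fun r hr => ?_
        rw [norm_mul]
        exact mul_le_mul (hγ r hr) (hV r hr) (norm_nonneg _) (by positivity)
    _ = _ := by
        rw [Finset.sum_const, nsmul_eq_mul, mul_assoc]

theorem norm_sum_mul_le_sqrt_mul {N : ℕ} (x y : ℕ → ℂ) (A : ℝ) (hA : 0 ≤ A)
    (hy : ∑ j ∈ range N, ‖y j‖ ^ 2 ≤ A ^ 2) :
    ‖∑ j ∈ range N, x j * y j‖ ≤ A * √(∑ j ∈ range N, ‖x j‖ ^ 2) := by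
  calc ‖∑ j ∈ range N, x j * y j‖ ≤ ∑ j ∈ range N, ‖x j‖ * ‖y j‖ :=
        norm_sum_le_of_le _ fun j _ => (norm_mul _ _).le
    _ ≤ √(∑ j ∈ range N, ‖x j‖ ^ 2) * √(∑ j ∈ range N, ‖y j‖ ^ 2) :=
        Real.sum_mul_le_sqrt_mul_sqrt _ _ _
    _ ≤ √(∑ j ∈ range N, ‖x j‖ ^ 2) * A := by
        gcongr
        exact Real.sqrt_le_iff.2 ⟨hA, hy⟩
    _ = _ := mul_comm _ _

/-- The values at a small root of the low-order part of a sequence annihilated by that root. -/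
theorem norm_low_part_le (np nm N : ℕ) (φ : ℕ → ℂ) (a : ℂ)
    (h0 : ∑ m ∈ range (np + N + nm), φ m * a ^ m = 0) (ρ A : ℝ) (hρ0 : 0 ≤ ρ) (hρ1 : ρ ≤ 1)
    (haρ : ‖a‖ ≤ ρ) (hA : 0 ≤ A) (hsum : ∑ i ∈ range (np + N + nm), (ρ ^ 2) ^ i ≤ A ^ 2) :
    ‖∑ m ∈ range np, φ m * a ^ m‖ ≤
      A * √(∑ j ∈ range N, ‖φ (np + j)‖ ^ 2) +
        ρ ^ N * ∑ j ∈ range nm, ‖φ (np + N + j)‖ := by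
  rw [Finset.sum_range_add, Finset.sum_range_add] at h0
  have h1 : ∑ m ∈ range np, φ m * a ^ m = -(∑ j ∈ range N, φ (np + j) * a ^ (np + j) +
      ∑ j ∈ range nm, φ (np + N + j) * a ^ (np + N + j)) := by
    linear_combination h0
  rw [h1, norm_neg]
  refine (norm_add_le _ _).trans (add_le_add ?_ ?_)
  · refine norm_sum_mul_le_sqrt_mul (fun j => φ (np + j)) (fun j => a ^ (np + j)) A hA ?_
    refine le_trans ?_ hsum
    calc ∑ j ∈ range N, ‖a ^ (np + j)‖ ^ 2 ≤ ∑ j ∈ range N, (ρ ^ 2) ^ (np + j) := by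
          refine Finset.sum_le_sum fun j _ => ?_
          rw [norm_pow, ← pow_mul, ← pow_mul, mul_comm 2]
          gcongr
      _ ≤ _ := sum_pow_le_of_injOn _ _ (by positivity) _
          (fun x _ y _ h => by simpa using h)
          (fun j hj => by have := Finset.mem_range.1 hj; omega)
  · rw [Finset.mul_sum]
    refine norm_sum_le_of_le _ fun j _ => ?_
    rw [norm_mul, norm_pow, mul_comm]
    gcongr
    calc ‖a‖ ^ (np + N + j) ≤ ρ ^ (np + N + j) := by gcongr
      _ ≤ ρ ^ N := pow_le_pow_of_le_one hρ0 hρ1 (by omega)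

/-- The values at a large root of the high-order part of a sequence annihilated by that root. -/
theorem norm_high_part_le (np nm N : ℕ) (φ : ℕ → ℂ) (b : ℂ) (hb : b ≠ 0)
    (h0 : ∑ m ∈ range (np + N + nm), φ m * b ^ m = 0) (σ B S : ℝ)
    (hbσ : ‖b‖⁻¹ ≤ σ) (hB : 0 ≤ B) (hsum : ∑ i ∈ range (np + N + 1), (σ ^ 2) ^ i ≤ B ^ 2)
    (hS : ∀ i ≤ np + N, σ ^ i ≤ S) :
    ‖∑ j ∈ range nm, φ (np + N + j) * b ^ j‖ ≤
      B * √(∑ j ∈ range N, ‖φ (np + j)‖ ^ 2) + S * ∑ m ∈ range np, ‖φ m‖ := by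
  have hσ : 0 ≤ σ := le_trans (by positivity) hbσ
  rw [Finset.sum_range_add, Finset.sum_range_add] at h0
  have hcancel : ∀ m ≤ np + N, (b⁻¹) ^ (np + N) * b ^ m = (b⁻¹) ^ (np + N - m) := by
    intro m hm
    obtain ⟨d, hd⟩ := Nat.exists_eq_add_of_le hm
    rw [hd, Nat.add_sub_cancel_left, pow_add, mul_right_comm, ← mul_pow, inv_mul_cancel₀ hb,
      one_pow, one_mul]
  have h1 : ∑ j ∈ range nm, φ (np + N + j) * b ^ j =
      -(∑ j ∈ range N, φ (np + j) * (b⁻¹) ^ (N - j) +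
        ∑ m ∈ range np, φ m * (b⁻¹) ^ (np + N - m)) := by
    have e1 : (b⁻¹) ^ (np + N) * ∑ m ∈ range np, φ m * b ^ m =
        ∑ m ∈ range np, φ m * (b⁻¹) ^ (np + N - m) := by
      rw [Finset.mul_sum]
      refine Finset.sum_congr rfl fun m hm => ?_
      rw [← hcancel m (by have := Finset.mem_range.1 hm; omega)]
      ring
    have e2 : (b⁻¹) ^ (np + N) * ∑ j ∈ range N, φ (np + j) * b ^ (np + j) =
        ∑ j ∈ range N, φ (np + j) * (b⁻¹) ^ (N - j) := by
      rw [Finset.mul_sum]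
      refine Finset.sum_congr rfl fun j hj => ?_
      rw [show N - j = np + N - (np + j) by omega,
        ← hcancel (np + j) (by have := Finset.mem_range.1 hj; omega)]
      ring
    have e3 : (b⁻¹) ^ (np + N) * ∑ j ∈ range nm, φ (np + N + j) * b ^ (np + N + j) =
        ∑ j ∈ range nm, φ (np + N + j) * b ^ j := by
      rw [Finset.mul_sum]
      refine Finset.sum_congr rfl fun j _ => ?_
      have := hcancel (np + N) le_rfl
      rw [Nat.sub_self, pow_zero] at this
      rw [pow_add b]
      linear_combination (φ (np + N + j) * b ^ j) * this
    rw [← e1, ← e2, ← e3]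
    linear_combination (b⁻¹) ^ (np + N) * h0
  rw [h1, norm_neg]
  refine (norm_add_le _ _).trans (add_le_add ?_ ?_)
  · refine norm_sum_mul_le_sqrt_mul (fun j => φ (np + j)) (fun j => (b⁻¹) ^ (N - j)) B hB ?_
    refine le_trans ?_ hsum
    calc ∑ j ∈ range N, ‖(b⁻¹) ^ (N - j)‖ ^ 2 ≤ ∑ j ∈ range N, (σ ^ 2) ^ (N - j) := by
          refine Finset.sum_le_sum fun j _ => ?_
          rw [norm_pow, norm_inv, ← pow_mul, ← pow_mul, mul_comm 2]
          gcongr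
      _ ≤ _ := sum_pow_le_of_injOn _ _ (by positivity) _
          (fun x hx y hy h => by simp at hx hy h; omega)
          (fun j _ => by omega)
  · rw [Finset.mul_sum]
    refine norm_sum_le_of_le _ fun m _ => ?_
    rw [norm_mul, norm_pow, norm_inv, mul_comm]
    gcongr
    calc ‖b‖⁻¹ ^ (np + N - m) ≤ σ ^ (np + N - m) := by gcongr
      _ ≤ S := hS _ (by omega)

/-- Solving the coupled estimates for the two boundary parts. -/
theorem boundary_parts_le {K M A B S F ε ξ η : ℝ} (hK : 0 ≤ K) (hM : 0 ≤ M)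
    (hF : 0 ≤ F) (hε : 0 ≤ ε) (hS : 0 ≤ S) (hξ0 : 0 ≤ ξ) (hξ : ξ ≤ K * (A * F + ε * η))
    (hη : η ≤ K * (B * F + S * ξ)) (hsmall : 2 * K ^ 2 * (ε * S) ≤ 1) (hεB : ε * B ≤ M * A)
    (hSA : S * A ≤ M * B) :
    ξ ≤ 2 * (K + K ^ 2 * M) * (A * F) ∧
      η ≤ (K + K * (2 * (K + K ^ 2 * M)) * M) * (B * F) := by
  have hξ' : ξ ≤ 2 * (K + K ^ 2 * M) * (A * F) := by
    have h1 : K * (ε * η) ≤ K * (ε * (K * (B * F + S * ξ))) := by gcongr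
    have h2 : K ^ 2 * F * (ε * B) ≤ K ^ 2 * F * (M * A) := by gcongr
    have h3 : 2 * K ^ 2 * (ε * S) * ξ ≤ 1 * ξ := by gcongr
    nlinarith
  refine ⟨hξ', ?_⟩
  have h1 : K * (S * ξ) ≤ K * (S * (2 * (K + K ^ 2 * M) * (A * F))) := by gcongr
  have h2 : K * (2 * (K + K ^ 2 * M)) * F * (S * A) ≤
      K * (2 * (K + K ^ 2 * M)) * F * (M * B) := by gcongr
  nlinarith

/-- The `ℓ²` size of the kernel applied to the three pieces of a sequence. -/
theorem sum_sq_greenKernel_le (np nm N : ℕ) (ψ : ℕ → ℝ) (hψ : ∀ m, 0 ≤ ψ m)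
    {ρ σ A B M : ℝ} (hρ : 0 ≤ ρ) (hσ : 0 ≤ σ) (hA : 0 ≤ A) (hB : 0 ≤ B) (hM : 0 ≤ M)
    (hρA : ∑ i ∈ range (np + N + nm), (ρ ^ 2) ^ i ≤ A ^ 2)
    (hσB : ∑ i ∈ range (np + N + 1), (σ ^ 2) ^ i ≤ B ^ 2)
    (hρAB : ∑ i ∈ range (np + N + nm), ρ ^ i ≤ M * (A * B))
    (hσAB : ∑ i ∈ range (np + N + 1), σ ^ i ≤ M * (A * B)) :
    ∑ k ∈ range N, (∑ m ∈ range (np + N + nm), greenKernel ρ σ k m * ψ m) ^ 2 ≤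
      3 * ((A ^ 2 + B ^ 2) * (∑ m ∈ range np, ψ m) ^ 2 +
        (2 * M * (A * B)) ^ 2 * ∑ j ∈ range N, ψ (np + j) ^ 2 +
        A ^ 2 * (∑ j ∈ range nm, ψ (np + N + j)) ^ 2) := by
  have hlow := sum_sq_kernel_le_of_col (range N) (range np) (greenKernel ρ σ) (A ^ 2 + B ^ 2)
    (fun m hm => by
      simp_rw [greenKernel_sq]
      have := Finset.mem_range.1 hm
      exact (sum_greenKernel_left_le (by positivity) (by positivity) N m (np + N + nm)
        (np + N + 1) (by omega) (by omega)).trans (add_le_add hρA hσB)) ψ (fun m _ => hψ m)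
  have hmid := sum_sq_kernel_le (range N) (range N) (fun k j => greenKernel ρ σ k (np + j))
    (fun k _ j _ => greenKernel_nonneg hρ hσ _ _) (2 * M * (A * B)) (by positivity)
    (fun k hk => by
      have := Finset.mem_range.1 hk
      exact (sum_greenKernel_right_le hρ hσ k np N (np + N + nm) (np + N + 1) (by omega)
        (by omega)).trans (by linarith))
    (fun j hj => by
      have := Finset.mem_range.1 hj
      exact (sum_greenKernel_left_le hρ hσ N (np + j) (np + N + nm) (np + N + 1) (by omega)
        (by omega)).trans (by linarith)) (fun j => ψ (np + j))
  have hhigh := sum_sq_kernel_le_of_col (range N) (range nm)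
    (fun k j => greenKernel ρ σ k (np + N + j)) (A ^ 2)
    (fun j hj => by
      simp_rw [greenKernel_sq]
      have := Finset.mem_range.1 hj
      exact (sum_greenKernel_above_le (by positivity) N (np + N + j) (np + N + nm) (by omega)
        (by omega)).trans hρA) (fun j => ψ (np + N + j)) (fun j _ => hψ _)
  refine le_trans ?_ (mul_le_mul_of_nonneg_left (add_le_add (add_le_add hlow hmid) hhigh)
    (by norm_num))
  rw [← Finset.sum_add_distrib, ← Finset.sum_add_distrib, Finset.mul_sum]
  refine Finset.sum_le_sum fun k _ => ?_
  rw [Finset.sum_range_add, Finset.sum_range_add]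
  generalize ∑ m ∈ range np, greenKernel ρ σ k m * ψ m = x
  generalize ∑ j ∈ range N, greenKernel ρ σ k (np + j) * ψ (np + j) = y
  generalize ∑ j ∈ range nm, greenKernel ρ σ k (np + N + j) * ψ (np + N + j) = w
  nlinarith [sq_nonneg (x - y), sq_nonneg (y - w), sq_nonneg (x - w)]

/-- The `ℓ²` norm of the first `N` terms of a sequence. -/
def seqNorm (N : ℕ) (x : ℕ → ℂ) : ℝ := √(∑ j ∈ range N, ‖x j‖ ^ 2)

/-- Quantitative control of decay rates `ρ` (small roots) and `σ` (inverses of large roots) on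
`N` sites: `A` and `B` bound the `ℓ²` norms of the powers of `ρ` and `σ`, `S` bounds the powers
of `σ`. -/
structure RateBounds (np nm N : ℕ) (κ M ρ σ A B S : ℝ) : Prop where
  rho_nonneg : 0 ≤ ρ
  rho_le_one : ρ ≤ 1
  sigma_nonneg : 0 ≤ σ
  A_nonneg : 0 ≤ A
  B_nonneg : 0 ≤ B
  sum_rho_sq : ∑ i ∈ range (np + N + nm), (ρ ^ 2) ^ i ≤ A ^ 2
  sum_sigma_sq : ∑ i ∈ range (np + N + 1), (σ ^ 2) ^ i ≤ B ^ 2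
  sum_rho : ∑ i ∈ range (np + N + nm), ρ ^ i ≤ M * (A * B)
  sum_sigma : ∑ i ∈ range (np + N + 1), σ ^ i ≤ M * (A * B)
  sigma_pow : ∀ i ≤ np + N, σ ^ i ≤ S
  small : κ * (ρ ^ N * S) ≤ 1
  rho_pow_B : ρ ^ N * B ≤ M * A
  S_A : S * A ≤ M * B

/-- If `p` has `np` roots of modulus at most `ρ` and `nm` roots of modulus at least `σ⁻¹`, all
separated, then `U` is controlled by the `N` middle coefficients of `p * U`. -/
theorem exists_seqNorm_coeff_le (np nm : ℕ) (hn : 0 < np + nm) (R : ℝ) (hR : 0 < R) :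
    ∃ κ : ℝ, ∀ M : ℝ, 1 ≤ M → ∃ Ct : ℝ, 0 < Ct ∧
      ∀ (sA sB : Finset ℂ), sA.card = np → sB.card = nm → Disjoint sA sB →
      (∀ x ∈ sA ∪ sB, ‖x‖ ≤ R) →
      (∀ x ∈ sA ∪ sB, ∀ y ∈ sA ∪ sB, x ≠ y → 1 / R ≤ ‖x - y‖) →
      ∀ c : ℂ, 1 / R ≤ ‖c‖ → ∀ p : Polynomial ℂ,
      p = Polynomial.C c * ∏ r ∈ sA ∪ sB, (Polynomial.X - Polynomial.C r) →
      ∀ (N : ℕ) (ρ σ A B S : ℝ), RateBounds np nm N κ M ρ σ A B S →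
      (∀ r ∈ sA, ‖r‖ ≤ ρ) → (∀ r ∈ sB, r ≠ 0 ∧ ‖r‖⁻¹ ≤ σ) →
      ∀ U : Polynomial ℂ, U.natDegree < N →
        seqNorm N U.coeff ≤ Ct * (A * B) * seqNorm N (fun j => (p * U).coeff (np + j)) := by
  obtain ⟨K₁, hK₁0, hK₁⟩ := exists_sum_coeff_le_of_eval_le R hR np
  obtain ⟨K₂, hK₂0, hK₂⟩ := exists_sum_coeff_le_of_eval_le R hR nm
  set K := max K₁ K₂ with hK
  have hK0 : 0 ≤ K := hK₁0.trans (le_max_left _ _)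
  refine ⟨2 * K ^ 2, fun M hM => ?_⟩
  have hM0 : 0 ≤ M := by linarith
  set c₁ := 2 * (K + K ^ 2 * M) with hc₁
  set c₂ := K + K * c₁ * M with hc₂
  have hc₁0 : 0 ≤ c₁ := by positivity
  have hc₂0 : 0 ≤ c₂ := by positivity
  set Γ : ℝ := (np + nm : ℕ) * R ^ (np + nm) with hΓ
  have hΓ0 : 0 < Γ := by positivity
  refine ⟨Γ * √(3 * ((M ^ 2 + 1) * c₁ ^ 2 + 4 * M ^ 2 + c₂ ^ 2)), by positivity, ?_⟩
  intro sA sB hsA hsB hdisj hsR hsep c hc p hp N ρ σ A B S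
    ⟨hρ0, hρ1, hσ0, hA0, hB0, hρA, hσB, hρAB, hσAB, hS, hsmall, hεB, hSA⟩ hAρ hBσ U hU
  have hcard : (sA ∪ sB).card = np + nm := by rw [Finset.card_union_of_disjoint hdisj, hsA, hsB]
  have hdegp : p.natDegree ≤ np + nm := by
    rw [hp, ← hcard]
    refine Polynomial.natDegree_C_mul_le _ _ |>.trans ?_
    rw [Polynomial.natDegree_finsetProd_X_sub_C_eq_card]
  have hdeg : (p * U).natDegree < np + N + nm := by
    have := Polynomial.natDegree_mul_le (p := p) (q := U)
    omega
  have hroot : ∀ r ∈ sA ∪ sB, ∑ m ∈ range (np + N + nm), (p * U).coeff m * r ^ m = 0 := by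
    intro r hr
    rw [← Polynomial.eval_eq_sum_range' hdeg, hp, Polynomial.eval_mul, Polynomial.eval_mul,
      Polynomial.eval_prod, Finset.prod_eq_zero hr (by simp)]
    simp
  set φ : ℕ → ℂ := (p * U).coeff with hφ
  set F := √(∑ j ∈ range N, ‖φ (np + j)‖ ^ 2) with hF
  have hF0 : 0 ≤ F := Real.sqrt_nonneg _
  set ξ := ∑ m ∈ range np, ‖φ m‖ with hξ
  set η := ∑ j ∈ range nm, ‖φ (np + N + j)‖ with hη
  have hξ0 : 0 ≤ ξ := Finset.sum_nonneg fun _ _ => norm_nonneg _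
  have hη0 : 0 ≤ η := Finset.sum_nonneg fun _ _ => norm_nonneg _
  have hS0 : 0 ≤ S := by linarith [hS 0 (by omega), pow_zero σ]
  have hξle : ξ ≤ K * (A * F + ρ ^ N * η) := by
    have hY : 0 ≤ A * F + ρ ^ N * η := by positivity
    refine (hK₁ sA hsA (fun x hx => hsR x (Finset.mem_union_left _ hx))
      (fun x hx y hy => hsep x (Finset.mem_union_left _ hx) y (Finset.mem_union_left _ hy)) φ
      _ hY fun a ha => ?_).trans (mul_le_mul_of_nonneg_right (le_max_left _ _) hY)
    exact norm_low_part_le np nm N φ a (hroot a (Finset.mem_union_left _ ha)) ρ A hρ0 hρ1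
      (hAρ a ha) hA0 hρA
  have hηle : η ≤ K * (B * F + S * ξ) := by
    have hY : 0 ≤ B * F + S * ξ := by positivity
    refine (hK₂ sB hsB (fun x hx => hsR x (Finset.mem_union_right _ hx))
      (fun x hx y hy => hsep x (Finset.mem_union_right _ hx) y (Finset.mem_union_right _ hy))
      (fun j => φ (np + N + j)) _ hY fun b hb => ?_).trans
      (mul_le_mul_of_nonneg_right (le_max_right _ _) hY)
    exact norm_high_part_le np nm N φ b (hBσ b hb).1 (hroot b (Finset.mem_union_right _ hb)) σ B S
      (hBσ b hb).2 hB0 hσB hS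
  obtain ⟨hξF, hηF⟩ := boundary_parts_le hK0 hM0 hF0 (by positivity) hS0 hξ0 hξle hηle hsmall
    hεB hSA
  rw [← hc₁] at hξF hηF
  rw [← hc₂] at hηF
  have hAB : A ≤ M * B := by
    have h1 : 1 ≤ S := by simpa using hS 0 (by omega)
    nlinarith
  have hne : (sA ∪ sB).Nonempty := by rw [← Finset.card_pos, hcard]; exact hn
  have hker := sum_sq_greenKernel_le np nm N (fun m => ‖φ m‖) (fun _ => norm_nonneg _) hρ0 hσ0
    hA0 hB0 hM0 hρA hσB hρAB hσAB
  have hF2 : ∑ j ∈ range N, ‖φ (np + j)‖ ^ 2 = F ^ 2 :=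
    (Real.sq_sqrt (Finset.sum_nonneg fun _ _ => sq_nonneg _)).symm
  have hbound : (A ^ 2 + B ^ 2) * ξ ^ 2 + (2 * M * (A * B)) ^ 2 * F ^ 2 + A ^ 2 * η ^ 2 ≤
      ((M ^ 2 + 1) * c₁ ^ 2 + 4 * M ^ 2 + c₂ ^ 2) * (A * B * F) ^ 2 := by
    have h1 : ξ ^ 2 ≤ (c₁ * (A * F)) ^ 2 := by gcongr
    have h2 : η ^ 2 ≤ (c₂ * (B * F)) ^ 2 := by gcongr
    have h3 : A ^ 2 ≤ (M * B) ^ 2 := by gcongr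
    calc _ ≤ ((M * B) ^ 2 + B ^ 2) * (c₁ * (A * F)) ^ 2 + (2 * M * (A * B)) ^ 2 * F ^ 2 +
          A ^ 2 * (c₂ * (B * F)) ^ 2 := by gcongr
      _ = _ := by ring
  have hpt : ∀ k ∈ range N, ‖U.coeff k‖ ^ 2 ≤
      Γ ^ 2 * (∑ m ∈ range (np + N + nm), greenKernel ρ σ k m * ‖φ m‖) ^ 2 := by
    intro k hk
    have hk' := Finset.mem_range.1 hk
    have := norm_coeff_le_sum_greenKernel R hR sA sB hne hsep c hc p U hp ρ σ hρ0 hσ0 hAρ hBσ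
      (np + N + nm) k hdeg (by omega)
    rw [hcard, ← hΓ] at this
    rw [← mul_pow]
    gcongr
  have hAF : seqNorm N (fun j => φ (np + j)) = F := rfl
  rw [hAF, seqNorm]
  refine Real.sqrt_le_iff.2 ⟨by positivity, ?_⟩
  calc ∑ k ∈ range N, ‖U.coeff k‖ ^ 2
      ≤ Γ ^ 2 * ∑ k ∈ range N,
        (∑ m ∈ range (np + N + nm), greenKernel ρ σ k m * ‖φ m‖) ^ 2 := by
        rw [Finset.mul_sum]; exact Finset.sum_le_sum hpt
    _ ≤ Γ ^ 2 * (3 * (((M ^ 2 + 1) * c₁ ^ 2 + 4 * M ^ 2 + c₂ ^ 2) * (A * B * F) ^ 2)) := by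
        gcongr
        refine hker.trans ?_
        rw [hF2]
        gcongr
    _ = _ := by
        have hsq := Real.sq_sqrt
          (show 0 ≤ 3 * ((M ^ 2 + 1) * c₁ ^ 2 + 4 * M ^ 2 + c₂ ^ 2) by positivity)
        linear_combination (-(Γ * (A * B) * F) ^ 2) * hsq

theorem sum_pow_le_inv {x : ℝ} (h0 : 0 ≤ x) (h1 : x < 1) (n : ℕ) :
    ∑ i ∈ range n, x ^ i ≤ (1 - x)⁻¹ := by
  rw [← tsum_geometric_of_lt_one h0 h1]
  exact (summable_geometric_of_lt_one h0 h1).sum_le_tsum _ fun i _ => by positivity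

theorem sum_sq_pow_le {x S : ℝ} (h0 : 0 ≤ x) (n : ℕ) (hS : ∀ i < n, x ^ i ≤ S) :
    ∑ i ∈ range n, (x ^ 2) ^ i ≤ S * ∑ i ∈ range n, x ^ i := by
  rw [Finset.mul_sum]
  refine Finset.sum_le_sum fun i hi => ?_
  rw [← pow_mul, mul_comm, pow_mul, sq]
  exact mul_le_mul_of_nonneg_right (hS i (Finset.mem_range.1 hi)) (by positivity)

theorem tendsto_log_div_natCast : Tendsto (fun N : ℕ => Real.log N / N) atTop (nhds 0) :=
  (Real.isLittleO_log_id_atTop.tendsto_div_nhds_zero).comp tendsto_natCast_atTop_atTop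

theorem tendsto_log_sq_div_natCast :
    Tendsto (fun N : ℕ => Real.log N ^ 2 / N) atTop (nhds 0) :=
  ((Real.isLittleO_pow_log_id_atTop (n := 2)).tendsto_div_nhds_zero).comp tendsto_natCast_atTop_atTop

theorem eventually_log_pos : ∀ᶠ N : ℕ in atTop, 0 < Real.log N := by
  filter_upwards [eventually_gt_atTop 1] with N hN
  exact Real.log_pos (by exact_mod_cast hN)

/-- Rates when no root in the closed disc is treated as a large root. -/
theorem eventually_rateBounds_of_gap (np nm : ℕ) (κ C₀ : ℝ) (hC₀ : 0 < C₀) :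
    ∀ᶠ N : ℕ in atTop, RateBounds np nm N κ 1 (1 - C₀ * Real.log N / N)
      (1 + C₀ * Real.log N / N)⁻¹ √(2 / (C₀ * Real.log N / N)) √(2 / (C₀ * Real.log N / N)) 1 := by
  have ht0 : Tendsto (fun N : ℕ => C₀ * Real.log N / N) atTop (nhds 0) := by
    simpa [mul_div_assoc] using tendsto_log_div_natCast.const_mul C₀
  have hexp : Tendsto (fun N : ℕ => |κ| * Real.exp (-(C₀ * Real.log N))) atTop (nhds 0) := by
    have : Tendsto (fun N : ℕ => C₀ * Real.log N) atTop atTop :=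
      (Real.tendsto_log_atTop.comp tendsto_natCast_atTop_atTop).const_mul_atTop hC₀
    simpa using (Real.tendsto_exp_neg_atTop_nhds_zero.comp this).const_mul |κ|
  filter_upwards [ht0.eventually (gt_mem_nhds one_pos), hexp.eventually (gt_mem_nhds one_pos),
    eventually_log_pos, eventually_gt_atTop 0] with N ht1 hκ hlog hN
  have hN' : (0 : ℝ) < N := by exact_mod_cast hN
  have htN : C₀ * Real.log N / N * N = C₀ * Real.log N := by field_simp
  have ht : 0 < C₀ * Real.log N / N := by positivity
  rw [← htN] at hκ
  generalize C₀ * Real.log N / N = t at *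
  have hσ1 : (1 + t)⁻¹ < 1 := inv_lt_one_of_one_lt₀ (by linarith)
  have hρ : ∀ n, ∑ i ∈ range n, (1 - t) ^ i ≤ 2 / t := fun n => by
    refine (sum_pow_le_inv (by linarith) (by linarith) n).trans ?_
    rw [show 1 - (1 - t) = t by ring, div_eq_mul_inv]
    have : 0 < t⁻¹ := by positivity
    linarith
  have hσ : ∀ n, ∑ i ∈ range n, ((1 + t)⁻¹) ^ i ≤ 2 / t := fun n => by
    refine (sum_pow_le_inv (by positivity) hσ1 n).trans ?_
    have : (1 - (1 + t)⁻¹)⁻¹ = (1 + t) / t := by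
      have h1 : 1 - (1 + t)⁻¹ = t / (1 + t) := by field_simp; ring
      rw [h1, inv_div]
    rw [this]
    gcongr
    linarith
  have hpow : (1 - t) ^ N ≤ 1 := pow_le_one₀ (by linarith) (by linarith)
  have hAA : √(2 / t) * √(2 / t) = 2 / t := Real.mul_self_sqrt (by positivity)
  constructor
  · linarith
  · linarith
  · positivity
  · positivity
  · positivity
  · rw [sq √_, hAA]
    refine (sum_sq_pow_le (S := 1) (by linarith) _ fun i _ =>
      pow_le_one₀ (by linarith) (by linarith)).trans ?_
    rw [one_mul]
    exact hρ _
  · rw [sq √_, hAA]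
    refine (sum_sq_pow_le (S := 1) (by positivity) _ fun i _ =>
      pow_le_one₀ (by positivity) hσ1.le).trans ?_
    rw [one_mul]
    exact hσ _
  · rw [hAA, one_mul]
    exact hρ _
  · rw [hAA, one_mul]
    exact hσ _
  · exact fun i _ => pow_le_one₀ (by positivity) hσ1.le
  · have h1 : (1 - t) ^ N ≤ Real.exp (-(t * N)) := by
      rw [show -(t * N) = N * (-t) by ring, Real.exp_nat_mul]
      exact pow_le_pow_left₀ (by linarith) (by linarith [Real.add_one_le_exp (-t)]) N
    have h2 : 0 ≤ (1 - t) ^ N := pow_nonneg (by linarith) N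
    rw [mul_one]
    calc κ * (1 - t) ^ N ≤ |κ| * Real.exp (-(t * N)) :=
          mul_le_mul (le_abs_self κ) h1 h2 (abs_nonneg κ)
      _ ≤ 1 := hκ.le
  · gcongr
  · exact le_rfl

theorem RateBounds.of_inv_one_sub {np nm N : ℕ} {κ ρ t S : ℝ} (hρ0 : 0 ≤ ρ) (hρ1 : ρ < 1)
    (ht : 0 < t) (ht1 : t < 1) (hS1 : 1 ≤ S) (hpowS : (1 - t)⁻¹ ^ (np + N) ≤ S)
    (hsm : |κ| * (ρ ^ N * S) + ρ ^ N * (S / t) ≤ 1) :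
    RateBounds np nm N κ (1 - ρ)⁻¹ ρ (1 - t)⁻¹ (1 - ρ)⁻¹ (S / t) S := by
  have hσpos : 0 < (1 - t)⁻¹ := inv_pos.2 (by linarith)
  have hσ1 : 1 ≤ (1 - t)⁻¹ := (one_le_inv₀ (by linarith)).2 (by linarith)
  have hS : ∀ i ≤ np + N, (1 - t)⁻¹ ^ i ≤ S := fun i hi =>
    (pow_le_pow_right₀ hσ1 hi).trans hpowS
  have hsumσ : ∑ i ∈ range (np + N + 1), (1 - t)⁻¹ ^ i ≤ S / t := by
    have hgs := geom_sum_eq (x := (1 - t)⁻¹) (by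
      intro h
      rw [inv_eq_one] at h
      linarith) (np + N + 1)
    rw [hgs]
    have h1 : (1 - t)⁻¹ - 1 = t * (1 - t)⁻¹ := by
      have : 1 - t ≠ 0 := by linarith
      field_simp
      ring
    rw [h1, div_le_div_iff₀ (by positivity) ht, pow_succ]
    linarith [mul_le_mul_of_nonneg_right hpowS (mul_pos ht hσpos).le]
  have hSt : S ≤ S / t := by
    rw [le_div_iff₀ ht]
    nlinarith
  have hA1 : 1 ≤ (1 - ρ)⁻¹ := (one_le_inv₀ (by linarith)).2 (by linarith)
  have hsumρ : ∀ n, ∑ i ∈ range n, ρ ^ i ≤ (1 - ρ)⁻¹ := sum_pow_le_inv hρ0 hρ1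
  generalize (1 - ρ)⁻¹ = A at *
  have hB1 : 1 ≤ S / t := hS1.trans hSt
  have hS0 : 0 ≤ S := by linarith
  have hA0 : 0 ≤ A := by linarith
  have hAA : 1 ≤ A * A := one_le_mul_of_one_le_of_one_le hA1 hA1
  have hρN : 0 ≤ ρ ^ N := by positivity
  have hnn1 : 0 ≤ ρ ^ N * (S / t) := by positivity
  have hnn2 : 0 ≤ |κ| * (ρ ^ N * S) := by positivity
  refine
    { rho_nonneg := hρ0, rho_le_one := hρ1.le, sigma_nonneg := hσpos.le, A_nonneg := hA0,
      B_nonneg := by positivity, sum_rho_sq := ?_, sum_sigma_sq := ?_, sum_rho := ?_,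
      sum_sigma := ?_, sigma_pow := hS, small := ?_, rho_pow_B := ?_, S_A := ?_ }
  · refine (sum_sq_pow_le (S := 1) hρ0 _ fun i _ => pow_le_one₀ hρ0 hρ1.le).trans ?_
    rw [one_mul, sq]
    exact (hsumρ _).trans (le_mul_of_one_le_left hA0 hA1)
  · refine (sum_sq_pow_le (S := S) hσpos.le _ fun i hi => hS i (by omega)).trans ?_
    rw [sq]
    gcongr
  · exact (hsumρ _).trans
      (le_mul_of_one_le_right hA0 (one_le_mul_of_one_le_of_one_le hA1 hB1))
  · refine hsumσ.trans ?_
    rw [← mul_assoc]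
    exact le_mul_of_one_le_left (by positivity) hAA
  · linarith [mul_le_mul_of_nonneg_right (le_abs_self κ) (mul_nonneg hρN hS0)]
  · linarith
  · rw [mul_comm]
    gcongr

/-- Rates when the roots close to the circle from inside are treated as large roots. -/
theorem eventually_rateBounds_of_near (np nm : ℕ) (κ ρ C₂ : ℝ) (hρ0 : 0 ≤ ρ) (hρ1 : ρ < 1)
    (hC₂ : 0 < C₂) :
    ∀ᶠ N : ℕ in atTop, RateBounds np nm N κ (1 - ρ)⁻¹ ρ (1 - C₂ * Real.log N / N)⁻¹ (1 - ρ)⁻¹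
      (Real.exp 1 * (N : ℝ) ^ C₂ / (C₂ * Real.log N / N)) (Real.exp 1 * (N : ℝ) ^ C₂) := by
  have ht0 : Tendsto (fun N : ℕ => C₂ * Real.log N / N) atTop (nhds 0) := by
    simpa [mul_div_assoc] using tendsto_log_div_natCast.const_mul C₂
  have hcorr : Tendsto (fun N : ℕ => (np + 1) * (C₂ * Real.log N / N) +
      C₂ ^ 2 * (Real.log N ^ 2 / N)) atTop (nhds 0) := by
    simpa using (ht0.const_mul ((np : ℝ) + 1)).add (tendsto_log_sq_div_natCast.const_mul (C₂ ^ 2))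
  have hgeom : Tendsto (fun N : ℕ => (|κ| + C₂⁻¹) * Real.exp 1 *
      ((N : ℝ) ^ (⌈C₂⌉₊ + 1) * ρ ^ N)) atTop (nhds 0) := by
    simpa using (tendsto_pow_const_mul_const_pow_of_abs_lt_one (⌈C₂⌉₊ + 1)
      (r := ρ) (by rwa [abs_of_nonneg hρ0])).const_mul ((|κ| + C₂⁻¹) * Real.exp 1)
  have hlog1 : ∀ᶠ N : ℕ in atTop, 1 ≤ Real.log N :=
    (Real.tendsto_log_atTop.comp tendsto_natCast_atTop_atTop).eventually_ge_atTop 1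
  filter_upwards [ht0.eventually (gt_mem_nhds one_pos), hcorr.eventually (gt_mem_nhds one_pos),
    hgeom.eventually (gt_mem_nhds one_pos), hlog1, eventually_gt_atTop 0]
    with N ht1 hc hg hlog hN
  have hN' : (1 : ℝ) ≤ N := by exact_mod_cast hN
  have htN : C₂ * Real.log N / N * N = C₂ * Real.log N := by field_simp
  have hcN : C₂ ^ 2 * (Real.log N ^ 2 / N) = N * (C₂ * Real.log N / N) ^ 2 := by
    field_simp
  have ht : 0 < C₂ * Real.log N / N := by positivity
  have hinv : (C₂ * Real.log N / N)⁻¹ ≤ C₂⁻¹ * N := by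
    rw [inv_div, div_eq_mul_inv, mul_comm, mul_inv]
    have : (Real.log N)⁻¹ ≤ 1 := inv_le_one_of_one_le₀ hlog
    have h2 : 0 ≤ C₂⁻¹ * N := by positivity
    nlinarith
  have hNC : (N : ℝ) ^ C₂ * N ≤ (N : ℝ) ^ (⌈C₂⌉₊ + 1) := by
    rw [pow_succ]
    gcongr
    rw [← Real.rpow_natCast]
    exact Real.rpow_le_rpow_of_exponent_le hN' (Nat.le_ceil C₂)
  have hNe : (N : ℝ) ^ C₂ = Real.exp (C₂ * Real.log N) := by
    rw [Real.rpow_def_of_pos (by linarith), mul_comm]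
  have hN1 : 1 ≤ (N : ℝ) ^ C₂ := Real.one_le_rpow hN' hC₂.le
  have hS1 : 1 ≤ Real.exp 1 * (N : ℝ) ^ C₂ := by
    nlinarith [Real.add_one_le_exp 1]
  rw [hcN] at hc
  rw [← htN] at hNe
  generalize C₂ * Real.log N / N = t at *
  have hσpos : 0 < (1 - t)⁻¹ := inv_pos.2 (by linarith)
  have hpowS : (1 - t)⁻¹ ^ (np + N) ≤ Real.exp 1 * (N : ℝ) ^ C₂ := by
    have h1 : (1 - t)⁻¹ ≤ Real.exp (t / (1 - t)) := by
      have : (1 - t)⁻¹ = t / (1 - t) + 1 := by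
        have : 1 - t ≠ 0 := by linarith
        field_simp
        ring
      rw [this]
      exact Real.add_one_le_exp _
    calc (1 - t)⁻¹ ^ (np + N) ≤ Real.exp (t / (1 - t)) ^ (np + N) := by gcongr
      _ = Real.exp ((np + N : ℕ) * (t / (1 - t))) := (Real.exp_nat_mul _ _).symm
      _ ≤ Real.exp (1 + t * N) := by
          refine Real.exp_le_exp.2 ?_
          rw [← mul_div_assoc, div_le_iff₀ (by linarith)]
          push_cast
          nlinarith
      _ = _ := by rw [Real.exp_add, hNe]
  set S := Real.exp 1 * (N : ℝ) ^ C₂ with hSdef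
  have hNC' : (N : ℝ) ^ C₂ ≤ (N : ℝ) ^ (⌈C₂⌉₊ + 1) := by nlinarith
  have hsm : |κ| * (ρ ^ N * S) + ρ ^ N * (S / t) ≤ 1 := by
    refine le_trans ?_ hg.le
    have h1 : S / t ≤ S * (C₂⁻¹ * N) := by
      rw [div_eq_mul_inv]; gcongr
    calc |κ| * (ρ ^ N * S) + ρ ^ N * (S / t)
        ≤ |κ| * (ρ ^ N * S) + ρ ^ N * (S * (C₂⁻¹ * N)) := by gcongr
      _ = |κ| * (Real.exp 1 * (N : ℝ) ^ C₂ * ρ ^ N) +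
          C₂⁻¹ * (Real.exp 1 * ((N : ℝ) ^ C₂ * N) * ρ ^ N) := by rw [hSdef]; ring
      _ ≤ |κ| * (Real.exp 1 * (N : ℝ) ^ (⌈C₂⌉₊ + 1) * ρ ^ N) +
          C₂⁻¹ * (Real.exp 1 * ((N : ℝ) ^ (⌈C₂⌉₊ + 1)) * ρ ^ N) := by gcongr
      _ = _ := by ring
  exact RateBounds.of_inv_one_sub hρ0 hρ1 ht ht1 hS1 hpowS hsm

theorem coeff_qPoly (np nm : ℕ) (q : ℂ → ℤ → ℂ) (z : ℂ)
    (hsupp : ∀ n : ℤ, n ∉ Finset.Icc (-(nm : ℤ)) (np : ℤ) → q z n = 0) (m : ℕ) :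
    (qPoly np nm q z).coeff m = q z ((np : ℤ) - m) := by
  rw [qPoly, Polynomial.finsetSum_coeff]
  simp only [Polynomial.coeff_C_mul, Polynomial.coeff_X_pow]
  rw [Finset.sum_eq_single ((np : ℤ) - m)]
  · rw [if_pos (by omega), mul_one]
  · intro n hn hne
    have := Finset.mem_Icc.1 hn
    rw [if_neg (by omega), mul_zero]
  · intro hn
    rw [hsupp _ hn, zero_mul]

theorem natDegree_qPoly (np nm : ℕ) (q : ℂ → ℤ → ℂ) (z : ℂ)
    (hsupp : ∀ n : ℤ, n ∉ Finset.Icc (-(nm : ℤ)) (np : ℤ) → q z n = 0)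
    (hlead : q z (-(nm : ℤ)) ≠ 0) : (qPoly np nm q z).natDegree = np + nm := by
  refine le_antisymm (Polynomial.natDegree_le_iff_coeff_eq_zero.2 fun m hm => ?_)
    (Polynomial.le_natDegree_of_ne_zero ?_)
  · rw [coeff_qPoly np nm q z hsupp]
    refine hsupp _ fun h => ?_
    have := Finset.mem_Icc.1 h
    omega
  · rw [coeff_qPoly np nm q z hsupp]
    push_cast
    rwa [show (np : ℤ) - (np + nm) = -nm by ring]

/-- The polynomial whose coefficients are the entries of `u` in reverse order. -/
def revPoly {N : ℕ} (u : Fin N → ℂ) : Polynomial ℂ :=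
  ∑ i : Fin N, Polynomial.C (u i) * Polynomial.X ^ (i.rev : ℕ)

theorem coeff_revPoly {N : ℕ} (u : Fin N → ℂ) (k : Fin N) : (revPoly u).coeff k = u k.rev := by
  rw [revPoly, Polynomial.finsetSum_coeff]
  simp only [Polynomial.coeff_C_mul, Polynomial.coeff_X_pow]
  rw [Finset.sum_eq_single k.rev]
  · simp
  · intro i _ hi
    rw [if_neg, mul_zero]
    intro h
    exact hi (by rw [Fin.ext h, Fin.rev_rev])
  · simp

theorem natDegree_revPoly_lt {N : ℕ} (hN : 0 < N) (u : Fin N → ℂ) :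
    (revPoly u).natDegree < N := by
  refine Nat.lt_of_le_pred hN (Polynomial.natDegree_sum_le_of_forall_le _ _ fun i _ => ?_)
  refine (Polynomial.natDegree_C_mul_X_pow_le _ _).trans ?_
  have := i.rev.isLt
  exact Nat.le_pred_of_lt this

theorem coeff_qPoly_mul_revPoly (np nm : ℕ) (q : ℂ → ℤ → ℂ) (z : ℂ)
    (hsupp : ∀ n : ℤ, n ∉ Finset.Icc (-(nm : ℤ)) (np : ℤ) → q z n = 0) {N : ℕ}
    (u : Fin N → ℂ) (k : Fin N) :
    (qPoly np nm q z * revPoly u).coeff (np + k) = (toepQ q z N).mulVec u k.rev := by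
  rw [revPoly, Finset.mul_sum, Polynomial.finsetSum_coeff, Matrix.mulVec, dotProduct]
  refine Finset.sum_congr rfl fun j _ => ?_
  rw [mul_left_comm, Polynomial.coeff_C_mul, Polynomial.coeff_mul_X_pow', toepQ, Matrix.of_apply,
    mul_comm]
  congr 1
  have hj := j.isLt
  have hk := k.isLt
  split_ifs with h
  · rw [coeff_qPoly np nm q z hsupp]
    congr 1
    rw [Fin.val_rev] at h
    rw [Fin.val_rev, Fin.val_rev]
    omega
  · refine (hsupp _ fun hmem => h ?_).symm
    have := Finset.mem_Icc.1 hmem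
    rw [Fin.val_rev] at this ⊢
    omega

theorem seqNorm_eq_l2norm_of_rev {N : ℕ} (x : ℕ → ℂ) (v : Fin N → ℂ)
    (h : ∀ k : Fin N, x k = v k.rev) : seqNorm N x = l2norm v := by
  rw [seqNorm, l2norm, ← Fin.sum_univ_eq_sum_range (fun j => ‖x j‖ ^ 2)]
  simp_rw [h]
  exact congrArg Real.sqrt (Equiv.sum_comp Fin.revPerm (fun i => ‖v i‖ ^ 2))

theorem isUnit_and_l2norm_inv_mulVec_le {N : ℕ} (T : Matrix (Fin N) (Fin N) ℂ) (K : ℝ)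
    (hT : ∀ u, l2norm u ≤ K * l2norm (T.mulVec u)) :
    IsUnit T ∧ ∀ v, l2norm (T⁻¹.mulVec v) ≤ K * l2norm v := by
  have hinj : Function.Injective T.mulVec := by
    intro u w huw
    have h0 : T.mulVec (u - w) = 0 := by rw [Matrix.mulVec_sub, huw, sub_self]
    have h1 := hT (u - w)
    have hz : l2norm (0 : Fin N → ℂ) = 0 := by simp [l2norm]
    rw [h0, hz, mul_zero] at h1
    have h2 := Real.sqrt_eq_zero'.1 (le_antisymm h1 (Real.sqrt_nonneg _))
    funext i
    have h3 := (Finset.sum_eq_zero_iff_of_nonneg fun i _ => sq_nonneg _).1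
      (le_antisymm h2 (Finset.sum_nonneg fun i _ => sq_nonneg ‖(u - w) i‖)) i (Finset.mem_univ i)
    have h4 : (u - w) i = 0 := by simpa using h3
    exact sub_eq_zero.1 h4
  have hunit : IsUnit T := Matrix.mulVec_injective_iff_isUnit.1 hinj
  refine ⟨hunit, fun v => ?_⟩
  have := hT (T⁻¹.mulVec v)
  rwa [Matrix.mulVec_mulVec, Matrix.mul_nonsing_inv _ ((Matrix.isUnit_iff_isUnit_det T).1 hunit),
    Matrix.one_mulVec] at this

/-- Bound on the inverse of a banded Toeplitz matrix whose symbol has simple separated roots,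
`np` of which are of modulus at most `ρ` and the others of modulus at least `σ⁻¹`. -/
theorem exists_toeplitz_inverse_bound (np nm : ℕ) (hn : 0 < np + nm) (R : ℝ) (hR : 0 < R) :
    ∃ κ : ℝ, ∀ M : ℝ, 1 ≤ M → ∃ Ct : ℝ, 0 < Ct ∧ ∀ (q : ℂ → ℤ → ℂ) (z : ℂ),
      (∀ n : ℤ, n ∉ Finset.Icc (-(nm : ℤ)) (np : ℤ) → q z n = 0) →
      1 / R ≤ ‖q z (-(nm : ℤ))‖ → (qPoly np nm q z).roots.Nodup →
      (∀ ζ ∈ (qPoly np nm q z).roots, ∀ ξ ∈ (qPoly np nm q z).roots,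
        ζ ≠ ξ → 1 / R ≤ ‖ζ - ξ‖) →
      (∀ ζ ∈ (qPoly np nm q z).roots, 0 < ‖ζ‖ ∧ ‖ζ‖ ≤ R) →
      ∀ N : ℕ, 0 < N → ∀ (P : ℂ → Prop) [DecidablePred P],
      Multiset.card ((qPoly np nm q z).roots.filter P) = np →
      ∀ ρ σ A B S : ℝ, RateBounds np nm N κ M ρ σ A B S →
      (∀ r ∈ (qPoly np nm q z).roots, P r → ‖r‖ ≤ ρ) →
      (∀ r ∈ (qPoly np nm q z).roots, ¬P r → ‖r‖⁻¹ ≤ σ) →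
      IsUnit (toepQ q z N) ∧
        ∀ v, l2norm ((toepQ q z N)⁻¹.mulVec v) ≤ Ct * (A * B) * l2norm v := by
  obtain ⟨κ, hκ⟩ := exists_seqNorm_coeff_le np nm hn R hR
  refine ⟨κ, fun M hM => ?_⟩
  obtain ⟨Ct, hCt, hmain⟩ := hκ M hM
  refine ⟨Ct, hCt, ?_⟩
  intro q z hsupp hlead hnodup hsep hsize N hN P _ hcard ρ σ A B S hrate hsmall hlarge
  have hlead0 : q z (-(nm : ℤ)) ≠ 0 := by
    rw [← norm_pos_iff]
    exact lt_of_lt_of_le (by positivity) hlead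
  have hdeg := natDegree_qPoly np nm q z hsupp hlead0
  have hlc : (qPoly np nm q z).leadingCoeff = q z (-(nm : ℤ)) := by
    rw [Polynomial.leadingCoeff, hdeg, coeff_qPoly np nm q z hsupp]
    congr 1
    push_cast
    ring
  have hroots : Multiset.card (qPoly np nm q z).roots = np + nm := by
    rw [← hdeg]
    exact (IsAlgClosed.splits _).natDegree_eq_card_roots.symm
  have hprod := Polynomial.C_leadingCoeff_mul_prod_multiset_X_sub_C (hroots.trans hdeg.symm)
  rw [hlc] at hprod
  set p := qPoly np nm q z with hp
  set sA := p.roots.toFinset.filter P with hsA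
  set sB := p.roots.toFinset.filter (fun r => ¬P r) with hsB
  have hunion : sA ∪ sB = p.roots.toFinset := Finset.filter_union_filter_not_eq _ _
  have hdisj : Disjoint sA sB := Finset.disjoint_filter_filter_not _ _ _
  have hcA : sA.card = np := by
    rw [hsA, ← Multiset.toFinset_filter, Multiset.toFinset_card_of_nodup (hnodup.filter _), hcard]
  have hcB : sB.card = nm := by
    have h1 := Finset.card_union_of_disjoint hdisj
    rw [hunion, Multiset.toFinset_card_of_nodup hnodup, hroots] at h1
    omega
  have hmem : ∀ x ∈ sA ∪ sB, x ∈ p.roots := fun x hx => by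
    rw [hunion] at hx
    exact Multiset.mem_toFinset.1 hx
  have hpform : p = Polynomial.C (q z (-(nm : ℤ))) *
      ∏ r ∈ sA ∪ sB, (Polynomial.X - Polynomial.C r) := by
    rw [hunion, Finset.prod, Multiset.toFinset_val, hnodup.dedup, hprod]
  refine isUnit_and_l2norm_inv_mulVec_le _ _ fun u => ?_
  have := hmain sA sB hcA hcB hdisj (fun x hx => (hsize x (hmem x hx)).2)
    (fun x hx y hy => hsep x (hmem x hx) y (hmem y hy)) _ hlead p hpform N ρ σ A B S hrate
    (fun r hr => hsmall r (hmem r (Finset.mem_union_left _ hr)) (Finset.mem_filter.1 hr).2)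
    (fun r hr => ⟨norm_pos_iff.1 (hsize r (hmem r (Finset.mem_union_right _ hr))).1,
      hlarge r (hmem r (Finset.mem_union_right _ hr)) (Finset.mem_filter.1 hr).2⟩)
    (revPoly u) (natDegree_revPoly_lt hN u)
  rwa [seqNorm_eq_l2norm_of_rev _ u (coeff_revPoly u),
    seqNorm_eq_l2norm_of_rev _ _ (coeff_qPoly_mul_revPoly np nm q z hsupp u)] at this

/-- **Theorem (resolvent bound).** Under the hypotheses (i)-(vi) on the family of symbols
`q_z`, `z ∈ Ω_N ⋐ Ω'`, the Toeplitz matrices `P_N(q_z)` are invertible for large `N`, with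
`‖P_N(q_z)⁻¹‖ ≤ C̃ N^{1 + C₂ Θ(m̂₀)} / log N` uniformly on `Ω_N`. -/
theorem toeplitz_resolvent_bound
    (np nm : ℕ) (hdeg : (nm = 0 → 0 < np) ∧ (np = 0 → 0 < nm))
    (q : ℂ → ℤ → ℂ)
    (hsupp : ∀ z : ℂ, ∀ n : ℤ, n ∉ Finset.Icc (-(nm : ℤ)) (np : ℤ) → q z n = 0)
    (Ω' : Set ℂ) (hΩ'o : IsOpen Ω') (hΩ'ne : Ω'.Nonempty) (hΩ'b : Bornology.IsBounded Ω')
    (ΩN : ℕ → Set ℂ)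
    (hΩN : ∀ N, IsOpen (ΩN N) ∧ (ΩN N).Nonempty ∧ closure (ΩN N) ⊆ Ω')
    (Cc : ℝ) (hCc : 0 < Cc)
    (hcoef : ∀ z ∈ Ω', q z np ≠ 0 ∧ 1 / Cc ≤ ‖q z (-(nm : ℤ))‖ ∧ ∀ n : ℤ, ‖q z n‖ ≤ Cc)
    (hsimple : ∀ z ∈ Ω', ((qPoly np nm q z).roots).Nodup)
    (hrootsep : ∀ z ∈ Ω', ∀ ζ ∈ (qPoly np nm q z).roots, ∀ ξ ∈ (qPoly np nm q z).roots,
      ζ ≠ ξ → 1 / Cc ≤ ‖ζ - ξ‖)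
    (hrootsize : ∀ z ∈ Ω', ∀ ζ ∈ (qPoly np nm q z).roots, 0 < ‖ζ‖ ∧ ‖ζ‖ ≤ Cc)
    (C₀ : ℝ) (hC₀ : 0 < C₀)
    (hcircle : ∀ᶠ N in atTop, ∀ z ∈ ΩN N,
      (∀ ζ : ℂ, ‖ζ‖ = 1 → qFun np nm q z ζ ≠ 0) ∧
      ∀ ζ ∈ (qPoly np nm q z).roots, C₀ * Real.log N / N ≤ |‖ζ‖ - 1|)
    (m₀ : ℕ) (C₁ C₂ : ℝ) (hC₁ : 1 < C₁) (hC₂ : 0 < C₂)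
    (hstruct : ∀ᶠ N in atTop, ∀ z ∈ ΩN N,
      m₀ ≤ Multiset.card (((qPoly np nm q z).roots).filter fun ζ => ‖ζ‖ < 1) ∧
      (∀ ζ ∈ (qPoly np nm q z).roots, ‖ζ‖ < 1 →
        (‖ζ‖ < 1 / C₁ ∨ 1 - C₂ * Real.log N / N ≤ ‖ζ‖)) ∧
      Multiset.card (((qPoly np nm q z).roots).filter fun ζ =>
        1 - C₂ * Real.log N / N ≤ ‖ζ‖ ∧ ‖ζ‖ < 1) = m₀ ∧
      1 / C₁ < 1 - C₂ * Real.log N / N)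
    (mh₀ : ℕ) (hmh₀ : mh₀ = 0 ∨ mh₀ = m₀)
    (hwind : ∀ᶠ N in atTop, ∀ z ∈ ΩN N,
      (Multiset.card (((qPoly np nm q z).roots).filter fun ζ => ‖ζ‖ < 1) : ℤ) - (np : ℤ) =
        (mh₀ : ℤ)) :
    ∃ Ct : ℝ, 0 < Ct ∧ ∀ᶠ N in atTop, ∀ z ∈ ΩN N,
      IsUnit (toepQ q z N) ∧
      ∀ v : Fin N → ℂ,
        l2norm ((toepQ q z N)⁻¹.mulVec v) ≤
          Ct * (N : ℝ) ^ ((1 : ℝ) + C₂ * thetaH mh₀) / Real.log N * l2norm v := by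
  have hn : 0 < np + nm := by
    rcases Nat.eq_zero_or_pos nm with h | h
    · have := hdeg.1 h
      omega
    · omega
  have hsub : ∀ N, ∀ z ∈ ΩN N, z ∈ Ω' := fun N z hz => (hΩN N).2.2 (subset_closure hz)
  obtain ⟨κ, hκ⟩ := exists_toeplitz_inverse_bound np nm hn Cc hCc
  rcases Nat.eq_zero_or_pos mh₀ with h0 | hpos
  · subst h0
    obtain ⟨Ct, hCt, hmain⟩ := hκ 1 le_rfl
    refine ⟨Ct * (2 / C₀), by positivity, ?_⟩
    filter_upwards [hcircle, hwind, eventually_rateBounds_of_gap np nm κ C₀ hC₀,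
      eventually_log_pos, eventually_gt_atTop 0] with N hcN hwN hrate hlog hN z hz
    have hN' : (0 : ℝ) < N := by exact_mod_cast hN
    have ht : 0 < C₀ * Real.log N / N := by positivity
    have hzΩ := hsub N z hz
    have hcirc := (hcN z hz).2
    obtain ⟨hunit, hbd⟩ := hmain q z (hsupp z) (hcoef z hzΩ).2.1 (hsimple z hzΩ)
      (hrootsep z hzΩ) (hrootsize z hzΩ) N hN (fun ζ => ‖ζ‖ < 1)
      (by have := hwN z hz; push_cast at this; omega) _ _ _ _ _ hrate
      (fun r hr hr1 => by
        have := hcirc r hr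
        rw [abs_of_neg (by linarith)] at this
        linarith)
      (fun r hr hr1 => by
        have := hcirc r hr
        rw [abs_of_nonneg (by linarith)] at this
        exact inv_anti₀ (by linarith) (by linarith))
    refine ⟨hunit, fun v => (hbd v).trans_eq ?_⟩
    rw [Real.mul_self_sqrt (by positivity), thetaH, if_pos rfl, mul_zero, add_zero, Real.rpow_one]
    field_simp
  · obtain rfl : mh₀ = m₀ := hmh₀.resolve_left hpos.ne'
    have hρ1 : 1 / C₁ < 1 := (div_lt_one (by linarith)).2 hC₁
    have hρ0 : 0 ≤ 1 / C₁ := by positivity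
    have hM : 1 ≤ (1 - 1 / C₁)⁻¹ := (one_le_inv₀ (by linarith)).2 (by linarith)
    obtain ⟨Ct, hCt, hmain⟩ := hκ _ hM
    refine ⟨Ct * ((1 - 1 / C₁)⁻¹ * (Real.exp 1 / C₂)), by positivity, ?_⟩
    filter_upwards [hstruct, hwind, eventually_rateBounds_of_near np nm κ (1 / C₁) C₂ hρ0 hρ1 hC₂,
      eventually_log_pos, eventually_gt_atTop 0] with N hsN hwN hrate hlog hN z hz
    have hN' : (0 : ℝ) < N := by exact_mod_cast hN
    have ht : 0 < C₂ * Real.log N / N := by positivity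
    have hzΩ := hsub N z hz
    obtain ⟨-, hdich, hcard, hgap⟩ := hsN z hz
    have hsmallcard : Multiset.card ((qPoly np nm q z).roots.filter fun ζ => ‖ζ‖ < 1 / C₁) =
        np := by
      have hw := hwN z hz
      have hadd := congrArg Multiset.card (Multiset.filter_add_not
        (fun ζ => ‖ζ‖ < 1 / C₁) ((qPoly np nm q z).roots.filter fun ζ => ‖ζ‖ < 1))
      rw [Multiset.card_add, Multiset.filter_filter, Multiset.filter_filter,
        Multiset.filter_congr (q := fun ζ => ‖ζ‖ < 1 / C₁) (fun ζ _ =>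
          ⟨fun h => h.1, fun h => ⟨h, h.trans hρ1⟩⟩),
        Multiset.filter_congr (p := fun ζ => ¬‖ζ‖ < 1 / C₁ ∧ ‖ζ‖ < 1)
          (q := fun ζ => 1 - C₂ * Real.log N / N ≤ ‖ζ‖ ∧ ‖ζ‖ < 1) (fun ζ hζ =>
          ⟨fun h => ⟨(hdich ζ hζ h.2).resolve_left h.1, h.2⟩,
            fun h => ⟨by linarith [h.1], h.2⟩⟩), hcard] at hadd
      omega
    obtain ⟨hunit, hbd⟩ := hmain q z (hsupp z) (hcoef z hzΩ).2.1 (hsimple z hzΩ)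
      (hrootsep z hzΩ) (hrootsize z hzΩ) N hN (fun ζ => ‖ζ‖ < 1 / C₁)
      hsmallcard _ _ _ _ _ hrate (fun r _ hr1 => hr1.le)
      (fun r hr hr1 => by
        refine inv_anti₀ (by linarith) ?_
        by_cases h : ‖r‖ < 1
        · exact (hdich r hr h).resolve_left hr1
        · linarith)
    refine ⟨hunit, fun v => (hbd v).trans_eq ?_⟩
    rw [thetaH, if_neg hpos.ne', mul_one, Real.rpow_add hN', Real.rpow_one]
    field_simp

end
end

section
/- Let H be an N-dimensional complex Hilbert space and let N ≥ M > 0. Suppose the block operator 𝒫 = [[P, R_-],[R_+, 0]] : H × ℂ^M → H × ℂ^M is bijective, with inverse written in block form as ℰ = [[E, E_+],[E_-, E_{-+}]]. Then E_+ maps the kernel 𝒩(E_{-+}) bijectively onto the kernel 𝒩(P), with inverse given by the restriction of R_+ to 𝒩(P); and E_-^* maps 𝒩(E_{-+}^*) bijectively onto 𝒩(P^*), with inverse given by the restriction of R_-^* to 𝒩(P^*). -/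
/-!
Well-posed Grushin problems: Lemma `lem-basicinverse`.
-/

open LinearMap

/-- The kernel correspondence for a Grushin problem over an arbitrary ring: the block identities
used say that `Ep` and `Rp` restrict to mutually inverse maps between `ker Emp` and `ker P`. -/
theorem ker_correspondence_of_block_inverse {R V W : Type*} [Ring R]
    [AddCommGroup V] [Module R V] [AddCommGroup W] [Module R W]
    {P E : V →ₗ[R] V} {Rm Ep : W →ₗ[R] V} {Rp Em : V →ₗ[R] W} {Emp : W →ₗ[R] W}
    (h12 : P ∘ₗ Ep + Rm ∘ₗ Emp = 0) (h22 : Rp ∘ₗ Ep = LinearMap.id)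
    (k11 : E ∘ₗ P + Ep ∘ₗ Rp = LinearMap.id) (k21 : Em ∘ₗ P + Emp ∘ₗ Rp = 0) :
    (∀ u ∈ LinearMap.ker Emp, Ep u ∈ LinearMap.ker P) ∧
    (∀ u ∈ LinearMap.ker Emp, Rp (Ep u) = u) ∧
    (∀ v ∈ LinearMap.ker P, Rp v ∈ LinearMap.ker Emp ∧ Ep (Rp v) = v) := by
  refine ⟨fun u hu => ?_, fun u _ => LinearMap.congr_fun h22 u, fun v hv => ⟨?_, ?_⟩⟩
  · simpa [LinearMap.mem_ker.mp hu] using LinearMap.congr_fun h12 u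
  · simpa [LinearMap.mem_ker.mp hv] using LinearMap.congr_fun k21 v
  · simpa [LinearMap.mem_ker.mp hv] using LinearMap.congr_fun k11 v

/-- **Lemma (well-posed Grushin problem).** Let `H` be an `N`-dimensional complex Hilbert
space and `N ≥ M > 0`.  Suppose the block operator `𝒫 = [[P, R₋], [R₊, 0]]` on `H × ℂ^M`
is bijective with inverse `ℰ = [[E, E₊], [E₋, E₋₊]]` (encoded by the eight block
identities `𝒫 ℰ = 1` and `ℰ 𝒫 = 1`).  Then `E₊ : 𝒩(E₋₊) → 𝒩(P)` is bijective with
inverse `R₊|_{𝒩(P)}`, and `E₋^* : 𝒩(E₋₊^*) → 𝒩(P^*)` is bijective with inverse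
`R₋^*|_{𝒩(P^*)}`. -/
theorem grushin_basic_inverse
    {H : Type*} [NormedAddCommGroup H] [InnerProductSpace ℂ H] [FiniteDimensional ℂ H]
    (N M : ℕ) (hdim : Module.finrank ℂ H = N) (hM : 0 < M) (hMN : M ≤ N)
    (P : H →ₗ[ℂ] H)
    (Rm : EuclideanSpace ℂ (Fin M) →ₗ[ℂ] H)
    (Rp : H →ₗ[ℂ] EuclideanSpace ℂ (Fin M))
    (E : H →ₗ[ℂ] H)
    (Ep : EuclideanSpace ℂ (Fin M) →ₗ[ℂ] H)
    (Em : H →ₗ[ℂ] EuclideanSpace ℂ (Fin M))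
    (Emp : EuclideanSpace ℂ (Fin M) →ₗ[ℂ] EuclideanSpace ℂ (Fin M))
    (h11 : P ∘ₗ E + Rm ∘ₗ Em = LinearMap.id)
    (h12 : P ∘ₗ Ep + Rm ∘ₗ Emp = 0)
    (h21 : Rp ∘ₗ E = 0)
    (h22 : Rp ∘ₗ Ep = LinearMap.id)
    (k11 : E ∘ₗ P + Ep ∘ₗ Rp = LinearMap.id)
    (k12 : E ∘ₗ Rm = 0)
    (k21 : Em ∘ₗ P + Emp ∘ₗ Rp = 0)
    (k22 : Em ∘ₗ Rm = LinearMap.id) :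
    (∀ u ∈ LinearMap.ker Emp, Ep u ∈ LinearMap.ker P) ∧
    (∀ u ∈ LinearMap.ker Emp, Rp (Ep u) = u) ∧
    (∀ v ∈ LinearMap.ker P, Rp v ∈ LinearMap.ker Emp ∧ Ep (Rp v) = v) ∧
    (∀ u ∈ LinearMap.ker (LinearMap.adjoint Emp),
      (LinearMap.adjoint Em) u ∈ LinearMap.ker (LinearMap.adjoint P)) ∧
    (∀ u ∈ LinearMap.ker (LinearMap.adjoint Emp),
      (LinearMap.adjoint Rm) ((LinearMap.adjoint Em) u) = u) ∧
    (∀ v ∈ LinearMap.ker (LinearMap.adjoint P),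
      (LinearMap.adjoint Rm) v ∈ LinearMap.ker (LinearMap.adjoint Emp) ∧
      (LinearMap.adjoint Em) ((LinearMap.adjoint Rm) v) = v) := by
  obtain ⟨ker_map, left_inv, right_inv⟩ := ker_correspondence_of_block_inverse h12 h22 k11 k21
  refine ⟨ker_map, left_inv, right_inv, ker_correspondence_of_block_inverse
    (Rm := LinearMap.adjoint Rp) (E := LinearMap.adjoint E) (Em := LinearMap.adjoint Ep)
    ?_ ?_ ?_ ?_⟩
  · simpa [LinearMap.adjoint_comp] using congrArg LinearMap.adjoint k21
  · simpa [LinearMap.adjoint_comp] using congrArg LinearMap.adjoint k22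
  · simpa [LinearMap.adjoint_comp] using congrArg LinearMap.adjoint h11
  · simpa [LinearMap.adjoint_comp] using congrArg LinearMap.adjoint h12
end
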